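/- arXiv:1111.0861 — 2 statements merged into one kernel-verified Lean document; each statement's English description precedes it below -/
import Mathlib

section
/- Let D ∈ H⁴ with fundamental invariants J₂, …, J₁₀. There exist g ∈ SO(3) and δ, σ ∈ ℝ with g·D = NF_tetra(δ, σ) (i.e., D lies in the closed tetragonal stratum) if and only if the following eight relations and one inequality hold: 6J₆ = −3J₂³ + 9J₂J₄ + 20J₃²; 3J₇ = J₂²J₃ − 3J₃J₄ + 3J₂J₅; 6J₄² = −3J₂⁴ + 9J₂²J₄ + 20J₂J₃² − 20J₃J₅; 5J₈ = −3J₂⁴ + 6J₂²J₄ + 30J₂J₃² − 5J₃J₅; 3J₄J₅ = 7J₂³J₃ − 15J₂J₃J₄ + 3J₂²J₅ − 60J₃³; 6J₉ = 5J₂³J₃ − 13J₂J₃J₄ + 6J₂²J₅ − 20J₃³; 5J₅² = −2J₂⁵ + 4J₂³J₄ + 10J₂²J₃² − 20J₂J₃J₅ + 30J₃²J₄; 15J₁₀ = −9J₂⁵ + 18J₂³J₄ + 85J₂²J₃² − 30J₂J₃J₅ + 15J₃²J₄; and 2J₂(J₂² − 3J₄)² − 35J₅² ≥ 0. Moreover,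 if in addition 3J₄ − J₂² ≠ 0 and 5J₂³ − 8J₂J₄ − 70J₃² ≠ 0, then g, δ, σ can be chosen with δ = −J₅ / (4(J₂² − 3J₄)), σ ≥ 0 and J₂ = 8σ² + 280δ². -/
open Matrix BigOperators

abbrev Mat3 := Matrix (Fin 3) (Fin 3) ℝ
abbrev T4 := Fin 3 → Fin 3 → Fin 3 → Fin 3 → ℝ

/-- `g ∈ SO(3)`: real orthogonal 3×3 matrix of determinant 1. -/
def IsSO3 (g : Mat3) : Prop := g * gᵀ = 1 ∧ g.det = 1

/-- A harmonic fourth-order tensor: totally symmetric and traceless. -/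
def IsHarm (D : T4) : Prop :=
  (∀ i j k l, D i j k l = D j i k l) ∧
  (∀ i j k l, D i j k l = D i k j l) ∧
  (∀ i j k l, D i j k l = D i j l k) ∧
  (∀ i j, ∑ k, D k k i j = 0)

/-- The action of a rotation `g` on a fourth-order tensor. -/
noncomputable def act (g : Mat3) (D : T4) : T4 := fun i j k l =>
  ∑ p, ∑ q, ∑ r, ∑ s, g i p * g j q * g k r * g l s * D p q r s

/-- `D²`, the square of a fourth-order tensor. -/
noncomputable def sqT (D : T4) : T4 := fun i j k l => ∑ p, ∑ q, D i j p q * D p q k l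

/-- `D³`, the cube of a fourth-order tensor. -/
noncomputable def cbT (D : T4) : T4 := fun i j k l => ∑ p, ∑ q, sqT D i j p q * D p q k l

/-- The second-order Boehler covariant `d₂(D) j l = ∑ᵢ (D²) i j i l`. -/
noncomputable def d2 (D : T4) : Mat3 := Matrix.of fun j l => ∑ i, sqT D i j i l

/-- The second-order covariant `d₃(D) j l = ∑ᵢ (D³) i j i l`. -/
noncomputable def d3 (D : T4) : Mat3 := Matrix.of fun j l => ∑ i, cbT D i j i l

/-- Fundamental invariant `J₂ = tr d₂`. -/
noncomputable def J2 (D : T4) : ℝ := (d2 D).trace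
/-- Fundamental invariant `J₃ = tr d₃`. -/
noncomputable def J3 (D : T4) : ℝ := (d3 D).trace
/-- Fundamental invariant `J₄ = tr(d₂²)`. -/
noncomputable def J4 (D : T4) : ℝ := (d2 D * d2 D).trace
/-- Fundamental invariant `J₅ = ∑ (d₂)ᵢⱼ D i j k l (d₂)ₖₗ`. -/
noncomputable def J5 (D : T4) : ℝ :=
  ∑ i, ∑ j, ∑ k, ∑ l, d2 D i j * D i j k l * d2 D k l
/-- Fundamental invariant `J₆ = tr(d₂³)`. -/
noncomputable def J6 (D : T4) : ℝ := (d2 D * d2 D * d2 D).trace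
/-- Fundamental invariant `J₇ = ∑ (d₂²)ᵢⱼ D i j k l (d₂)ₖₗ`. -/
noncomputable def J7 (D : T4) : ℝ :=
  ∑ i, ∑ j, ∑ k, ∑ l, (d2 D * d2 D) i j * D i j k l * d2 D k l
/-- Fundamental invariant `J₈ = ∑ (d₂²)ᵢⱼ (D²) i j k l (d₂)ₖₗ`. -/
noncomputable def J8 (D : T4) : ℝ :=
  ∑ i, ∑ j, ∑ k, ∑ l, (d2 D * d2 D) i j * sqT D i j k l * d2 D k l
/-- Fundamental invariant `J₉ = ∑ (d₂²)ᵢⱼ D i j k l (d₂²)ₖₗ`. -/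
noncomputable def J9 (D : T4) : ℝ :=
  ∑ i, ∑ j, ∑ k, ∑ l, (d2 D * d2 D) i j * D i j k l * (d2 D * d2 D) k l
/-- Fundamental invariant `J₁₀ = ∑ (d₂²)ᵢⱼ (D²) i j k l (d₂²)ₖₗ`. -/
noncomputable def J10 (D : T4) : ℝ :=
  ∑ i, ∑ j, ∑ k, ∑ l, (d2 D * d2 D) i j * sqT D i j k l * (d2 D * d2 D) k l

/-- The totally symmetric tensor whose value at `(i,j,k,l)` depends only on the
multiset of indices `{i,j,k,l}`. -/
noncomputable def symT (f : Multiset (Fin 3) → ℝ) : T4 := fun i j k l => f {i, j, k, l}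

/-- Normal form of a cubic (`[𝕆]`) tensor in `H⁴` with parameter `δ`
(indices `0,1,2` correspond to `1,2,3`). -/
noncomputable def NFcubic (δ : ℝ) : T4 := symT fun m =>
  if m = {0, 0, 0, 0} ∨ m = {1, 1, 1, 1} ∨ m = {2, 2, 2, 2} then 8 * δ
  else if m = {0, 0, 1, 1} ∨ m = {0, 0, 2, 2} ∨ m = {1, 1, 2, 2} then -(4 * δ)
  else 0

/-- Normal form of a transversely isotropic (`[O(2)]`) tensor in `H⁴` with parameter `δ`. -/
noncomputable def NFti (δ : ℝ) : T4 := symT fun m =>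
  if m = {0, 0, 0, 0} ∨ m = {1, 1, 1, 1} then 3 * δ
  else if m = {2, 2, 2, 2} then 8 * δ
  else if m = {0, 0, 1, 1} then δ
  else if m = {0, 0, 2, 2} ∨ m = {1, 1, 2, 2} then -(4 * δ)
  else 0

/-- Normal form of a trigonal (`[𝔻₃]`) tensor in `H⁴` with parameters `δ, σ`. -/
noncomputable def NFtrig (δ σ : ℝ) : T4 := symT fun m =>
  if m = {0, 0, 0, 0} ∨ m = {1, 1, 1, 1} then 3 * δ
  else if m = {2, 2, 2, 2} then 8 * δ
  else if m = {0, 0, 1, 1} then δ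
  else if m = {0, 0, 2, 2} ∨ m = {1, 1, 2, 2} then -(4 * δ)
  else if m = {0, 0, 1, 2} then -σ
  else if m = {1, 1, 1, 2} then σ
  else 0

/-- Normal form of a tetragonal (`[𝔻₄]`) tensor in `H⁴` with parameters `δ, σ`. -/
noncomputable def NFtetra (δ σ : ℝ) : T4 := symT fun m =>
  if m = {0, 0, 0, 0} ∨ m = {1, 1, 1, 1} then 3 * δ - σ
  else if m = {2, 2, 2, 2} then 8 * δ
  else if m = {0, 0, 1, 1} then δ + σ
  else if m = {0, 0, 2, 2} ∨ m = {1, 1, 2, 2} then -(4 * δ)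
  else 0

/-- Normal form of an orthotropic (`[𝔻₂]`) tensor in `H⁴` with parameters `λ₁, λ₂, λ₃`. -/
noncomputable def NForth (l1 l2 l3 : ℝ) : T4 := symT fun m =>
  if m = {0, 0, 0, 0} then -l2 - l3
  else if m = {1, 1, 1, 1} then -l1 - l3
  else if m = {2, 2, 2, 2} then -l1 - l2
  else if m = {0, 0, 1, 1} then l3
  else if m = {0, 0, 2, 2} then l2
  else if m = {1, 1, 2, 2} then l1
  else 0

open scoped Kronecker

/-- A fourth-order tensor viewed as an endomorphism of second-order tensors. -/
def toMat (D : T4) : Matrix (Fin 3 × Fin 3) (Fin 3 × Fin 3) ℝ :=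
  Matrix.of fun x y => D x.1 x.2 y.1 y.2

/-- The second-order tensor obtained from `D` by freezing its last two indices. -/
def slice (D : T4) (k l : Fin 3) : Mat3 := Matrix.of fun i j => D i j k l

/-- The second-order tensor obtained from `D` by freezing its second and fourth indices. -/
def slice' (D : T4) (j l : Fin 3) : Mat3 := Matrix.of fun i k => D i j k l

lemma toMat_injective : Function.Injective toMat := fun D E h => by
  funext i j k l
  exact congrFun (congrFun h (i, j)) (k, l)

lemma toMat_act (g : Mat3) (D : T4) : toMat (act g D) = (g ⊗ₖ g) * toMat D * (g ⊗ₖ g)ᵀ := by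
  ext ⟨i, j⟩ ⟨k, l⟩
  simp only [toMat, act, of_apply, mul_apply, kroneckerMap_apply, transpose_apply,
    Fintype.sum_prod_type, Fin.sum_univ_three]
  ring

lemma toMat_sqT (D : T4) : toMat (sqT D) = toMat D * toMat D := by
  ext ⟨i, j⟩ ⟨k, l⟩
  simp [toMat, sqT, mul_apply, Fintype.sum_prod_type]

lemma IsSO3.transpose_mul {g : Mat3} (hg : IsSO3 g) : gᵀ * g = 1 :=
  mul_eq_one_comm.mp hg.1

lemma kronecker_orthogonal {g : Mat3} (hg : gᵀ * g = 1) : (g ⊗ₖ g)ᵀ * (g ⊗ₖ g) = 1 := by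
  rw [← kroneckerMap_transpose, ← mul_kronecker_mul, hg, one_kronecker_one]

lemma act_act (g h : Mat3) (D : T4) : act g (act h D) = act (g * h) D := by
  apply toMat_injective
  simp only [toMat_act, mul_kronecker_mul, transpose_mul, Matrix.mul_assoc]

lemma act_neg (g : Mat3) (D : T4) : act (-g) D = act g D := by
  funext i j k l
  simp [act]

lemma IsSO3.mul {g h : Mat3} (hg : IsSO3 g) (hh : IsSO3 h) : IsSO3 (g * h) := by
  refine ⟨?_, by rw [det_mul, hg.2, hh.2, one_mul]⟩
  rw [Matrix.transpose_mul, Matrix.mul_assoc, ← Matrix.mul_assoc h, hh.1, Matrix.one_mul, hg.1]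

lemma sqT_act {g : Mat3} (hg : gᵀ * g = 1) (D : T4) : sqT (act g D) = act g (sqT D) := by
  apply toMat_injective
  rw [toMat_sqT, toMat_act, toMat_act, toMat_sqT]
  calc _ = (g ⊗ₖ g) * toMat D * ((g ⊗ₖ g)ᵀ * (g ⊗ₖ g)) * toMat D * (g ⊗ₖ g)ᵀ := by
        simp only [Matrix.mul_assoc]
    _ = _ := by rw [kronecker_orthogonal hg, Matrix.mul_one]; simp only [Matrix.mul_assoc]

lemma trace_conj {n : Type*} [Fintype n] [DecidableEq n] {g : Matrix n n ℝ} (hg : gᵀ * g = 1)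
    (S : Matrix n n ℝ) : (g * S * gᵀ).trace = S.trace := by
  rw [trace_mul_comm, ← Matrix.mul_assoc, hg, Matrix.one_mul]

lemma slice_act (g : Mat3) (D : T4) (k l : Fin 3) :
    slice (act g D) k l = ∑ r, ∑ s, (g k r * g l s) • (g * slice D r s * gᵀ) := by
  ext i j
  simp only [slice, act, of_apply, Fin.sum_univ_three, Matrix.add_apply,
    Matrix.smul_apply, mul_apply, transpose_apply, smul_eq_mul]
  ring

lemma slice'_act (g : Mat3) (D : T4) (j l : Fin 3) :
    slice' (act g D) j l = ∑ q, ∑ s, (g j q * g l s) • (g * slice' D q s * gᵀ) := by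
  ext i k
  simp only [slice', act, of_apply, Fin.sum_univ_three, Matrix.add_apply,
    Matrix.smul_apply, mul_apply, transpose_apply, smul_eq_mul]
  ring

lemma d2_eq_trace (D : T4) (j l : Fin 3) : d2 D j l = (slice' (sqT D) j l).trace := rfl

lemma d2_act {g : Mat3} (hg : gᵀ * g = 1) (D : T4) : d2 (act g D) = g * d2 D * gᵀ := by
  ext j l
  rw [d2_eq_trace, sqT_act hg, slice'_act]
  simp only [Fin.sum_univ_three, trace_add, trace_smul, trace_conj hg, ← d2_eq_trace, mul_apply,
    transpose_apply, smul_eq_mul]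
  ring

lemma IsHarm.act {g : Mat3} (hg : gᵀ * g = 1) {D : T4} (hD : IsHarm D) : IsHarm (act g D) := by
  obtain ⟨h1, h2, h3, h4⟩ := hD
  refine ⟨fun i j k l => ?_, fun i j k l => ?_, fun i j k l => ?_, fun i j => ?_⟩
  · unfold _root_.act
    rw [Finset.sum_comm]
    refine Finset.sum_congr rfl fun p _ => Finset.sum_congr rfl fun q _ =>
      Finset.sum_congr rfl fun r _ => Finset.sum_congr rfl fun s _ => ?_
    rw [h1]; ring
  · unfold _root_.act
    refine Finset.sum_congr rfl fun p _ => ?_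
    rw [Finset.sum_comm]
    refine Finset.sum_congr rfl fun q _ =>
      Finset.sum_congr rfl fun r _ => Finset.sum_congr rfl fun s _ => ?_
    rw [h2]; ring
  · unfold _root_.act
    refine Finset.sum_congr rfl fun p _ => Finset.sum_congr rfl fun q _ => ?_
    rw [Finset.sum_comm]
    refine Finset.sum_congr rfl fun r _ => Finset.sum_congr rfl fun s _ => ?_
    rw [h3]; ring
  · have h (r s : Fin 3) : (slice D r s).trace = 0 := h4 r s
    change (slice (_root_.act g D) i j).trace = 0
    simp [slice_act, trace_sum, trace_smul, trace_conj hg, h]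

/-- The double contraction of a fourth-order tensor with two second-order tensors. -/
noncomputable def contract (A : Mat3) (D : T4) (B : Mat3) : ℝ :=
  ∑ i, ∑ j, ∑ k, ∑ l, A i j * D i j k l * B k l

lemma contract_eq (A : Mat3) (D : T4) (B : Mat3) :
    contract A D B = vec Aᵀ ⬝ᵥ (toMat D *ᵥ vec Bᵀ) := by
  simp only [contract, dotProduct, mulVec, toMat, vec, Fintype.sum_prod_type, of_apply,
    transpose_apply, Finset.mul_sum, mul_assoc]

lemma contract_act {g : Mat3} (hg : gᵀ * g = 1) (A : Mat3) (D : T4) (B : Mat3) :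
    contract (g * A * gᵀ) (act g D) (g * B * gᵀ) = contract A D B := by
  have h (S : Mat3) : vec (g * S * gᵀ)ᵀ = (g ⊗ₖ g) *ᵥ vec Sᵀ := by
    rw [kronecker_mulVec_vec]; simp [Matrix.mul_assoc]
  rw [contract_eq, contract_eq, h, h, toMat_act, mulVec_mulVec, Matrix.mul_assoc,
    Matrix.mul_assoc, kronecker_orthogonal hg, Matrix.mul_one, dotProduct_mulVec,
    vecMul_mulVec, ← Matrix.mul_assoc, kronecker_orthogonal hg, Matrix.one_mul,
    dotProduct_mulVec]

lemma J3_eq (D : T4) : J3 D = (toMat (sqT D) * toMat D).trace := by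
  simp only [J3, d3, cbT, trace, diag_apply, of_apply, toMat, mul_apply, Fintype.sum_prod_type]
  rw [Finset.sum_comm]

lemma J3_act {g : Mat3} (hg : gᵀ * g = 1) (D : T4) : J3 (act g D) = J3 D := by
  rw [J3_eq, J3_eq, sqT_act hg, toMat_act, toMat_act,
    ← trace_conj (kronecker_orthogonal hg) (toMat (sqT D) * toMat D)]
  congr 1
  calc _ = (g ⊗ₖ g) * toMat (sqT D) * ((g ⊗ₖ g)ᵀ * (g ⊗ₖ g)) * toMat D * (g ⊗ₖ g)ᵀ := by
        simp only [Matrix.mul_assoc]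
    _ = _ := by rw [kronecker_orthogonal hg, Matrix.mul_one]; simp only [Matrix.mul_assoc]

lemma conj_mul_conj {g : Mat3} (hg : gᵀ * g = 1) (A B : Mat3) :
    g * A * gᵀ * (g * B * gᵀ) = g * (A * B) * gᵀ := by
  calc _ = g * A * (gᵀ * g) * B * gᵀ := by simp only [Matrix.mul_assoc]
    _ = _ := by rw [hg, Matrix.mul_one]; simp only [Matrix.mul_assoc]

section Invariance

variable {g : Mat3} (hg : gᵀ * g = 1) (D : T4)
include hg

lemma J2_act : J2 (act g D) = J2 D := by
  rw [J2, d2_act hg, trace_conj hg, J2]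

lemma J4_act : J4 (act g D) = J4 D := by
  rw [J4, d2_act hg, conj_mul_conj hg, trace_conj hg, J4]

lemma J5_act : J5 (act g D) = J5 D := by
  change contract _ _ _ = contract _ _ _
  rw [d2_act hg, contract_act hg]

lemma J6_act : J6 (act g D) = J6 D := by
  rw [J6, d2_act hg, conj_mul_conj hg, conj_mul_conj hg, trace_conj hg, J6]

lemma J7_act : J7 (act g D) = J7 D := by
  change contract _ _ _ = contract _ _ _
  rw [d2_act hg, conj_mul_conj hg, contract_act hg]

lemma J8_act : J8 (act g D) = J8 D := by
  change contract _ _ _ = contract _ _ _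
  rw [d2_act hg, conj_mul_conj hg, sqT_act hg, contract_act hg]

lemma J9_act : J9 (act g D) = J9 D := by
  change contract _ _ _ = contract _ _ _
  rw [d2_act hg, conj_mul_conj hg, contract_act hg]

lemma J10_act : J10 (act g D) = J10 D := by
  change contract _ _ _ = contract _ _ _
  rw [d2_act hg, conj_mul_conj hg, sqT_act hg, contract_act hg]

end Invariance

lemma d2_eq {D : T4} (hD : IsHarm D) (j l : Fin 3) :
    d2 D j l = D 0 0 0 j * D 0 0 0 l + 3 * (D 0 0 1 j * D 0 0 1 l) + 3 * (D 0 0 2 j * D 0 0 2 l)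
      + 3 * (D 0 1 1 j * D 0 1 1 l) + 6 * (D 0 1 2 j * D 0 1 2 l) + 3 * (D 0 2 2 j * D 0 2 2 l)
      + D 1 1 1 j * D 1 1 1 l + 3 * (D 1 1 2 j * D 1 1 2 l) + 3 * (D 1 2 2 j * D 1 2 2 l)
      + D 2 2 2 j * D 2 2 2 l := by
  obtain ⟨h1, h2, h3, -⟩ := hD
  have h (a b c : Fin 3) : D a j b c = D a b c j := by rw [h2, h3]
  simp only [d2, sqT, of_apply, Fin.sum_univ_three, h, h1 1 0, h1 2 1, h1 2 0, h2 _ 1 0, h2 _ 2 0,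
    h2 _ 2 1]
  ring

lemma IsHarm.trace_eqs {D : T4} (hD : IsHarm D) :
    D 0 0 0 0 = - D 0 0 1 1 - D 0 0 2 2 ∧ D 1 1 1 1 = - D 0 0 1 1 - D 1 1 2 2 ∧
    D 2 2 2 2 = - D 0 0 2 2 - D 1 1 2 2 ∧ D 0 1 1 1 = - D 0 0 0 1 - D 0 1 2 2 ∧
    D 0 1 1 2 = - D 0 0 0 2 - D 0 2 2 2 ∧ D 1 1 1 2 = - D 0 0 1 2 - D 1 2 2 2 := by
  obtain ⟨h1, h2, h3, h4⟩ := hD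
  have e (i j) := h4 i j
  simp only [Fin.sum_univ_three] at e
  have e00 := e 0 0
  have e01 := e 0 1
  have e02 := e 0 2
  have e11 := e 1 1
  have e12 := e 1 2
  have e22 := e 2 2
  simp only [h1 1 0, h1 2 1, h1 2 0, h2 _ 1 0, h2 _ 2 0, h2 _ 2 1, h3 _ _ 1 0, h3 _ _ 2 0,
    h3 _ _ 2 1] at e00 e01 e02 e11 e12 e22
  refine ⟨?_, ?_, ?_, ?_, ?_, ?_⟩ <;> linarith

/-- Two harmonic tensors agree as soon as nine of their components do. -/
lemma IsHarm.ext {D E : T4} (hD : IsHarm D) (hE : IsHarm E)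
    (h1 : D 0 0 1 1 = E 0 0 1 1) (h2 : D 0 0 2 2 = E 0 0 2 2) (h3 : D 1 1 2 2 = E 1 1 2 2)
    (h4 : D 0 0 0 1 = E 0 0 0 1) (h5 : D 0 1 2 2 = E 0 1 2 2) (h6 : D 0 0 0 2 = E 0 0 0 2)
    (h7 : D 0 2 2 2 = E 0 2 2 2) (h8 : D 0 0 1 2 = E 0 0 1 2) (h9 : D 1 2 2 2 = E 1 2 2 2) :
    D = E := by
  obtain ⟨a1, a2, a3, a4, a5, a6⟩ := hD.trace_eqs
  obtain ⟨b1, b2, b3, b4, b5, b6⟩ := hE.trace_eqs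
  rw [h1, h2, ← b1] at a1
  rw [h1, h3, ← b2] at a2
  rw [h2, h3, ← b3] at a3
  rw [h4, h5, ← b4] at a4
  rw [h6, h7, ← b5] at a5
  rw [h8, h9, ← b6] at a6
  obtain ⟨d1, d2, d3, -⟩ := hD
  obtain ⟨e1, e2, e3, -⟩ := hE
  funext i j k l
  fin_cases i <;> fin_cases j <;> fin_cases k <;> fin_cases l <;>
    simp [d1 1 0, d1 2 1, d1 2 0, d2 _ 1 0, d2 _ 2 0, d2 _ 2 1, d3 _ _ 1 0, d3 _ _ 2 0,
      d3 _ _ 2 1, e1 1 0, e1 2 1, e1 2 0, e2 _ 1 0, e2 _ 2 0, e2 _ 2 1, e3 _ _ 1 0, e3 _ _ 2 0,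
      e3 _ _ 2 1, *]

lemma NFtetra_isHarm (δ σ : ℝ) : IsHarm (NFtetra δ σ) := by
  have h (f : Multiset (Fin 3) → ℝ) : (∀ i j k l, symT f i j k l = symT f j i k l) ∧
      (∀ i j k l, symT f i j k l = symT f i k j l) ∧
      (∀ i j k l, symT f i j k l = symT f i j l k) := by
    refine ⟨fun i j k l => ?_, fun i j k l => ?_, fun i j k l => ?_⟩ <;> unfold symT <;>
      congr 1 <;> simp only [Multiset.insert_eq_cons]
    · exact Multiset.cons_swap _ _ _
    · rw [Multiset.cons_swap j]
    · exact congrArg (i ::ₘ j ::ₘ ·) (Multiset.pair_comm k l)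
  refine ⟨(h _).1, (h _).2.1, (h _).2.2, fun i j => ?_⟩
  fin_cases i <;> fin_cases j <;> simp +decide [NFtetra, symT, Fin.sum_univ_three] <;> ring

section DiagonalCovariant

variable {D : T4} {a b : ℝ} (hD : IsHarm D) (hd : d2 D = diagonal ![a, a, b])
include hd

lemma J2_of_diagonal : J2 D = 2 * a + b := by
  rw [J2, hd, trace_diagonal, Fin.sum_univ_three]
  simp; ring

lemma J4_of_diagonal : J4 D = 2 * a ^ 2 + b ^ 2 := by
  rw [J4, hd, diagonal_mul_diagonal, trace_diagonal, Fin.sum_univ_three]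
  simp; ring

lemma J6_of_diagonal : J6 D = 2 * a ^ 3 + b ^ 3 := by
  rw [J6, hd, diagonal_mul_diagonal, diagonal_mul_diagonal, trace_diagonal, Fin.sum_univ_three]
  simp; ring

include hD

lemma J5_of_diagonal : J5 D = (b - a) ^ 2 * D 2 2 2 2 := by
  obtain ⟨t1, t2, t3, -⟩ := hD.trace_eqs
  obtain ⟨h1, h2, h3, -⟩ := hD
  rw [J5, hd]
  simp [Fin.sum_univ_three, diagonal_apply, h1 1 0, h1 2 1, h1 2 0, h2 _ 1 0, h2 _ 2 0, h2 _ 2 1,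
    h3 _ _ 1 0, h3 _ _ 2 0, h3 _ _ 2 1, t1, t2, t3]
  ring

lemma J7_of_diagonal : J7 D = (b - a) ^ 2 * (a + b) * D 2 2 2 2 := by
  obtain ⟨t1, t2, t3, -⟩ := hD.trace_eqs
  obtain ⟨h1, h2, h3, -⟩ := hD
  rw [J7, hd, diagonal_mul_diagonal]
  simp [Fin.sum_univ_three, diagonal_apply, h1 1 0, h1 2 1, h1 2 0, h2 _ 1 0, h2 _ 2 0, h2 _ 2 1,
    h3 _ _ 1 0, h3 _ _ 2 0, h3 _ _ 2 1, t1, t2, t3]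
  ring

lemma J9_of_diagonal : J9 D = (b - a) ^ 2 * (a + b) ^ 2 * D 2 2 2 2 := by
  obtain ⟨t1, t2, t3, -⟩ := hD.trace_eqs
  obtain ⟨h1, h2, h3, -⟩ := hD
  rw [J9, hd, diagonal_mul_diagonal]
  simp [Fin.sum_univ_three, diagonal_apply, h1 1 0, h1 2 1, h1 2 0, h2 _ 1 0, h2 _ 2 0, h2 _ 2 1,
    h3 _ _ 1 0, h3 _ _ 2 0, h3 _ _ 2 1, t1, t2, t3]
  ring

lemma J8_of_diagonal : J8 D = (b - a) ^ 2 * (a + b) * (D 2 2 2 2 ^ 2 + D 0 0 2 2 ^ 2 +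
    D 1 1 2 2 ^ 2 + 2 * D 0 1 2 2 ^ 2 + 2 * D 0 2 2 2 ^ 2 + 2 * D 1 2 2 2 ^ 2) := by
  obtain ⟨t1, t2, t3, t4, t5, t6⟩ := hD.trace_eqs
  obtain ⟨h1, h2, h3, -⟩ := hD
  rw [J8, hd, diagonal_mul_diagonal]
  simp [sqT, Fin.sum_univ_three, diagonal_apply, h1 1 0, h1 2 1, h1 2 0, h2 _ 1 0, h2 _ 2 0,
    h2 _ 2 1, h3 _ _ 1 0, h3 _ _ 2 0, h3 _ _ 2 1, t1, t2, t3, t4, t5, t6]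
  ring

lemma J10_of_diagonal : J10 D = (b - a) ^ 2 * (a + b) ^ 2 * (D 2 2 2 2 ^ 2 + D 0 0 2 2 ^ 2 +
    D 1 1 2 2 ^ 2 + 2 * D 0 1 2 2 ^ 2 + 2 * D 0 2 2 2 ^ 2 + 2 * D 1 2 2 2 ^ 2) := by
  obtain ⟨t1, t2, t3, t4, t5, t6⟩ := hD.trace_eqs
  obtain ⟨h1, h2, h3, -⟩ := hD
  rw [J10, hd, diagonal_mul_diagonal]
  simp [sqT, Fin.sum_univ_three, diagonal_apply, h1 1 0, h1 2 1, h1 2 0, h2 _ 1 0, h2 _ 2 0,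
    h2 _ 2 1, h3 _ _ 1 0, h3 _ _ 2 0, h3 _ _ 2 1, t1, t2, t3, t4, t5, t6]
  ring

end DiagonalCovariant

lemma d2_NFtetra (δ σ : ℝ) : d2 (NFtetra δ σ) =
    diagonal ![60 * δ ^ 2 + 4 * σ ^ 2, 60 * δ ^ 2 + 4 * σ ^ 2, 160 * δ ^ 2] := by
  ext i j
  rw [d2_eq (NFtetra_isHarm δ σ)]
  fin_cases i <;> fin_cases j <;> simp +decide [NFtetra, symT] <;> ring

lemma J3_NFtetra (δ σ : ℝ) : J3 (NFtetra δ σ) = 12 * δ * (60 * δ ^ 2 + 4 * σ ^ 2) := by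
  rw [J3_eq]
  simp +decide [trace, mul_apply, toMat, Fintype.sum_prod_type, sqT, Fin.sum_univ_three,
    NFtetra, symT]
  ring

/-- The rotation about the third axis with cosine `c` and sine `s`. -/
def rotZ (c s : ℝ) : Mat3 := !![c, -s, 0; s, c, 0; 0, 0, 1]

lemma rotZ_isSO3 {c s : ℝ} (h : c ^ 2 + s ^ 2 = 1) : IsSO3 (rotZ c s) := by
  constructor
  · ext i j
    fin_cases i <;> fin_cases j <;> simp [rotZ, mul_apply, Fin.sum_univ_three] <;> grind
  · simp [rotZ, det_fin_three]
    linarith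

lemma exists_double_angle (α β : ℝ) : ∃ c s : ℝ, c ^ 2 + s ^ 2 = 1 ∧
    α * (2 * c * s) + β * (c ^ 2 - s ^ 2) = 0 ∧ 0 ≤ α * (c ^ 2 - s ^ 2) - β * (2 * c * s) := by
  set w : ℂ := ⟨α, β⟩
  have h1 : α = ‖w‖ * Real.cos w.arg := (Complex.norm_mul_cos_arg w).symm
  have h2 : β = ‖w‖ * Real.sin w.arg := (Complex.norm_mul_sin_arg w).symm
  set t := -w.arg / 2 with ht
  have h3 : Real.cos w.arg = Real.cos t ^ 2 - Real.sin t ^ 2 := by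
    rw [← Real.cos_two_mul', ht, ← Real.cos_neg]; congr 1; ring
  have h4 : Real.sin w.arg = -(2 * Real.sin t * Real.cos t) := by
    rw [← Real.sin_two_mul, ht, ← Real.sin_neg]; congr 1; ring
  have h5 := Real.cos_sq_add_sin_sq t
  rw [h3] at h1
  rw [h4] at h2
  refine ⟨Real.cos t, Real.sin t, h5, ?_, ?_⟩
  · rw [h1, h2]; ring
  · have : α * (Real.cos t ^ 2 - Real.sin t ^ 2) - β * (2 * Real.cos t * Real.sin t) =
        ‖w‖ * (Real.cos t ^ 2 + Real.sin t ^ 2) ^ 2 := by rw [h1, h2]; ring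
    rw [this]
    positivity

lemma exists_quadruple_angle (α β : ℝ) : ∃ c s : ℝ, c ^ 2 + s ^ 2 = 1 ∧
    α * (4 * c * s * (c ^ 2 - s ^ 2)) + β * (c ^ 4 - 6 * c ^ 2 * s ^ 2 + s ^ 4) = 0 ∧
    0 ≤ α * (c ^ 4 - 6 * c ^ 2 * s ^ 2 + s ^ 4) - β * (4 * c * s * (c ^ 2 - s ^ 2)) := by
  obtain ⟨c, s, h, h1, h2⟩ := exists_double_angle α β
  obtain ⟨c', s', h', h1', h2'⟩ := exists_double_angle c s
  have u : (c * (c' ^ 2 - s' ^ 2) - s * (2 * c' * s')) ^ 2 = 1 := by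
    linear_combination -(c * (2 * c' * s') + s * (c' ^ 2 - s' ^ 2)) * h1' +
      (c' ^ 2 + s' ^ 2) ^ 2 * h + (c' ^ 2 + s' ^ 2 + 1) * h'
  have u1 : c * (c' ^ 2 - s' ^ 2) - s * (2 * c' * s') = 1 := by nlinarith
  have v' : (c' ^ 2 - s' ^ 2) ^ 2 + (2 * c' * s') ^ 2 = 1 := by
    linear_combination (c' ^ 2 + s' ^ 2 + 1) * h'
  have hc : c = c' ^ 2 - s' ^ 2 := by
    linear_combination (c' ^ 2 - s' ^ 2) * u1 + (2 * c' * s') * h1' - c * v'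
  have hs : s = -(2 * c' * s') := by
    linear_combination (-2 * c' * s') * u1 + (c' ^ 2 - s' ^ 2) * h1' - s * v'
  refine ⟨c', -s', by linarith [h'], ?_, ?_⟩
  · rw [hc, hs] at h1
    linear_combination h1
  · rw [hc, hs] at h2
    linarith [h2]

/-- `D` lies in the closed tetragonal stratum, with a nonnegative second parameter. -/
def IsTetragonal (D : T4) : Prop :=
  ∃ (g : Mat3) (δ σ : ℝ), IsSO3 g ∧ act g D = NFtetra δ σ ∧ 0 ≤ σ

lemma IsTetragonal.of_act {h : Mat3} (hh : IsSO3 h) {D : T4} (H : IsTetragonal (act h D)) :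
    IsTetragonal D := by
  obtain ⟨g, δ, σ, hg, e, hσ⟩ := H
  exact ⟨g * h, δ, σ, hg.mul hh, by rw [← act_act, e], hσ⟩

lemma isTetragonal_of_axis {D : T4} (hD : IsHarm D) (h1 : D 0 2 2 2 = 0) (h2 : D 1 2 2 2 = 0)
    (h3 : D 0 1 2 2 = 0) (h4 : D 0 0 2 2 = D 1 1 2 2) (h5 : D 0 0 0 2 = 0) (h6 : D 0 0 1 2 = 0) :
    IsTetragonal D := by
  obtain ⟨c, s, h, e1, e2⟩ := exists_quadruple_angle (D 0 0 1 1 + D 1 1 2 2 / 4) (- D 0 0 0 1)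
  have hg := rotZ_isSO3 h
  have hD' := hD.act hg.transpose_mul
  refine ⟨rotZ c s, - D 1 1 2 2 / 4, (D 0 0 1 1 + D 1 1 2 2 / 4) *
    (c ^ 4 - 6 * c ^ 2 * s ^ 2 + s ^ 4) - (- D 0 0 0 1) * (4 * c * s * (c ^ 2 - s ^ 2)),
    hg, hD'.ext (NFtetra_isHarm _ _) ?_ ?_ ?_ ?_ ?_ ?_ ?_ ?_ ?_, e2⟩ <;>
  obtain ⟨t1, t2, t3, t4, t5, t6⟩ := hD.trace_eqs <;>
  obtain ⟨a1, a2, a3, -⟩ := hD <;>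
  simp +decide [NFtetra, symT, act, rotZ, Fin.sum_univ_three, a1 1 0, a1 2 1, a1 2 0, a2 _ 1 0,
    a2 _ 2 0, a2 _ 2 1, a3 _ _ 1 0, a3 _ _ 2 0, a3 _ _ 2 1, h1, h2, h3, h4, h5, h6, t1, t2, t3,
    t4, t5, t6]
  · linear_combination (-D 1 1 2 2 / 4) * (c ^ 2 + s ^ 2 + 1) * h
  · linear_combination D 1 1 2 2 * h
  · linear_combination D 1 1 2 2 * h
  · linear_combination -e1
  · ring

lemma d2_comm {D : T4} (hD : IsHarm D) (j l : Fin 3) : d2 D j l = d2 D l j := by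
  rw [d2_eq hD, d2_eq hD]; ring

lemma exists_act_d2_diagonal {D : T4} (hD : IsHarm D) :
    ∃ (g : Mat3) (v : Fin 3 → ℝ), IsSO3 g ∧ d2 (act g D) = diagonal v := by
  have hA : (d2 D).IsHermitian := by
    ext i j
    simp [d2_comm hD i j]
  set U : Mat3 := hA.eigenvectorUnitary.1 with hU
  have h1 : Uᵀ * U = 1 := by
    have := Unitary.coe_star_mul_self hA.eigenvectorUnitary
    simpa [star_eq_conjTranspose] using this
  have h2 : U * Uᵀ = 1 := mul_eq_one_comm.mp h1
  have h3 : d2 D = U * diagonal hA.eigenvalues * Uᵀ := by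
    have := hA.spectral_theorem
    simpa [Unitary.conjStarAlgAut_apply, star_eq_conjTranspose, ← hU, Function.comp_def] using this
  generalize hA.eigenvalues = v at h3
  have hd : d2 (act Uᵀ D) = diagonal v := by
    rw [d2_act (by simpa using h2), h3]
    calc _ = (Uᵀ * U) * diagonal v * (Uᵀ * U) := by
          simp only [transpose_transpose, Matrix.mul_assoc]
      _ = _ := by simp [h1]
  have hdet : U.det ^ 2 = 1 := by
    have := congrArg det h1
    rwa [det_mul, det_transpose, det_one, ← sq] at this
  rcases eq_or_eq_neg_of_sq_eq_sq U.det 1 (by rw [hdet, one_pow]) with h | h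
  · exact ⟨Uᵀ, _, ⟨by simpa using h1, by simpa using h⟩, hd⟩
  · exact ⟨-Uᵀ, _, ⟨by simpa using h1, by norm_num [det_neg, h]⟩, by rw [act_neg, hd]⟩

/-- The cyclic permutation of the coordinate axes. -/
def cycl : Mat3 := !![0, 1, 0; 0, 0, 1; 1, 0, 0]

lemma cycl_isSO3 : IsSO3 cycl := by
  constructor
  · ext i j
    fin_cases i <;> fin_cases j <;> simp [cycl, mul_apply, Fin.sum_univ_three]
  · simp [cycl, det_fin_three]

lemma d2_act_cycl {D : T4} {v : Fin 3 → ℝ} (h : d2 D = diagonal v) :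
    d2 (act cycl D) = diagonal ![v 1, v 2, v 0] := by
  rw [d2_act cycl_isSO3.transpose_mul, h]
  ext i j
  fin_cases i <;> fin_cases j <;> simp [cycl, mul_apply, Fin.sum_univ_three, diagonal_apply, vecMul,
    dotProduct]

/-- If `d2 D` has a repeated eigenvalue, some rotation brings it to the form `diag(a, a, b)`. -/
lemma exists_act_d2_uniaxial {D : T4} (hD : IsHarm D)
    (h : (J4 D - J2 D ^ 2 / 3) ^ 3 = 6 * (J6 D - J2 D * J4 D + 2 / 9 * J2 D ^ 3) ^ 2) :
    ∃ (g : Mat3) (a b : ℝ), IsSO3 g ∧ d2 (act g D) = diagonal ![a, a, b] := by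
  obtain ⟨g, v, hg, hv⟩ := exists_act_d2_diagonal hD
  have hv' : diagonal v = diagonal ![v 0, v 1, v 2] := by
    congr 1; ext i; fin_cases i <;> rfl
  rw [← J4_act hg.transpose_mul, ← J2_act hg.transpose_mul, ← J6_act hg.transpose_mul, J2, J4, J6,
    hv, diagonal_mul_diagonal, diagonal_mul_diagonal, trace_diagonal, trace_diagonal,
    trace_diagonal, Fin.sum_univ_three, Fin.sum_univ_three, Fin.sum_univ_three] at h
  have h0 : ((v 0 - v 1) * (v 1 - v 2) * (v 2 - v 0)) ^ 2 = 0 := by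
    linear_combination (1 / 2) * h
  rw [sq_eq_zero_iff, mul_eq_zero, mul_eq_zero, sub_eq_zero, sub_eq_zero, sub_eq_zero] at h0
  rcases h0 with (h0 | h0) | h0
  · exact ⟨g, v 1, v 2, hg, by rw [hv, hv', h0]⟩
  · refine ⟨cycl * g, v 2, v 0, cycl_isSO3.mul hg, ?_⟩
    rw [← act_act, d2_act_cycl hv, h0]
  · refine ⟨cycl * (cycl * g), v 0, v 1, cycl_isSO3.mul (cycl_isSO3.mul hg), ?_⟩
    rw [← act_act, ← act_act, d2_act_cycl (d2_act_cycl hv)]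
    simp [h0]

lemma isTetragonal_of_relations {D : T4} {a b : ℝ} (hD : IsHarm D)
    (hd : d2 D = diagonal ![a, a, b]) (hab : a ≠ b)
    (r1 : 6 * J6 D = -3 * (J2 D) ^ 3 + 9 * J2 D * J4 D + 20 * (J3 D) ^ 2)
    (r3 : 6 * (J4 D) ^ 2 = -3 * (J2 D) ^ 4 + 9 * (J2 D) ^ 2 * J4 D +
      20 * J2 D * (J3 D) ^ 2 - 20 * J3 D * J5 D)
    (r4 : 5 * J8 D = -3 * (J2 D) ^ 4 + 6 * (J2 D) ^ 2 * J4 D +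
      30 * J2 D * (J3 D) ^ 2 - 5 * J3 D * J5 D)
    (r7 : 5 * (J5 D) ^ 2 = -2 * (J2 D) ^ 5 + 4 * (J2 D) ^ 3 * J4 D +
      10 * (J2 D) ^ 2 * (J3 D) ^ 2 - 20 * J2 D * J3 D * J5 D + 30 * (J3 D) ^ 2 * J4 D) :
    IsTetragonal D := by
  have ha := d2_eq hD 0 0
  have hb := d2_eq hD 2 2
  rw [hd] at ha hb
  obtain ⟨-, -, t3, -, t5, t6⟩ := hD.trace_eqs
  simp only [diagonal_apply_eq, cons_val] at ha hb
  rw [J2_of_diagonal hd, J4_of_diagonal hd] at r1 r3 r4 r7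
  rw [J6_of_diagonal hd] at r1
  rw [J8_of_diagonal hD hd] at r4
  rw [J5_of_diagonal hD hd] at r3 r4 r7
  have ha0 : 0 ≤ a := by rw [ha]; simp only [← sq]; positivity
  have hb0 : 0 ≤ b := by rw [hb]; simp only [← sq]; positivity
  have hs : a + b ≠ 0 := fun h => hab (by linarith)
  have hc : b - a ≠ 0 := sub_ne_zero.mpr hab.symm
  have y2 : 10 * J3 D ^ 2 = 9 * a ^ 2 * b := by linear_combination -r1 / 2
  have yz : 5 * J3 D * D 2 2 2 2 = 3 * a * b := by
    refine mul_left_cancel₀ (pow_ne_zero 2 hc) ?_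
    linear_combination r3 / 4 + (2 * a + b) / 2 * y2
  have zz : 5 * D 2 2 2 2 ^ 2 = 2 * b := by
    refine mul_left_cancel₀ (pow_ne_zero 4 hc) ?_
    linear_combination r7 + ((2 * a + b) ^ 2 + 3 * (2 * a ^ 2 + b ^ 2)) * y2 -
      4 * (2 * a + b) * (b - a) ^ 2 * yz
  have ww : 5 * (D 2 2 2 2 ^ 2 + D 0 0 2 2 ^ 2 + D 1 1 2 2 ^ 2 + 2 * D 0 1 2 2 ^ 2 +
      2 * D 0 2 2 2 ^ 2 + 2 * D 1 2 2 2 ^ 2) = 3 * b := by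
    refine mul_left_cancel₀ (mul_ne_zero (pow_ne_zero 2 hc) hs) ?_
    linear_combination r4 + 3 * (2 * a + b) * y2 - (b - a) ^ 2 * yz
  have key : (D 0 0 2 2 - D 1 1 2 2) ^ 2 + 4 * D 0 1 2 2 ^ 2 + 4 * D 0 2 2 2 ^ 2 +
      4 * D 1 2 2 2 ^ 2 = 0 := by
    rw [t3] at ww zz
    linear_combination 2 / 5 * ww - 3 / 5 * zz
  have h1 : D 0 2 2 2 = 0 := by
    refine pow_eq_zero_iff two_ne_zero |>.mp (le_antisymm ?_ (sq_nonneg _))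
    linarith only [key, sq_nonneg (D 0 0 2 2 - D 1 1 2 2), sq_nonneg (D 0 1 2 2),
      sq_nonneg (D 1 2 2 2)]
  have h2 : D 1 2 2 2 = 0 := by
    refine pow_eq_zero_iff two_ne_zero |>.mp (le_antisymm ?_ (sq_nonneg _))
    linarith only [key, sq_nonneg (D 0 0 2 2 - D 1 1 2 2), sq_nonneg (D 0 1 2 2),
      sq_nonneg (D 0 2 2 2)]
  have h3 : D 0 1 2 2 = 0 := by
    refine pow_eq_zero_iff two_ne_zero |>.mp (le_antisymm ?_ (sq_nonneg _))
    linarith only [key, sq_nonneg (D 0 0 2 2 - D 1 1 2 2), sq_nonneg (D 0 2 2 2),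
      sq_nonneg (D 1 2 2 2)]
  have h4 : D 0 0 2 2 = D 1 1 2 2 := by
    refine sub_eq_zero.mp (pow_eq_zero_iff two_ne_zero |>.mp (le_antisymm ?_ (sq_nonneg _)))
    linarith only [key, sq_nonneg (D 0 1 2 2), sq_nonneg (D 0 2 2 2), sq_nonneg (D 1 2 2 2)]
  have hAB : D 0 0 0 2 ^ 2 + D 0 0 1 2 ^ 2 = 0 := by
    rw [t3, h4] at zz
    rw [t3, t5, t6, h1, h2, h3, h4] at hb
    linear_combination -hb / 4 - zz / 8
  have h5 : D 0 0 0 2 = 0 := by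
    refine pow_eq_zero_iff two_ne_zero |>.mp (le_antisymm ?_ (sq_nonneg _))
    linarith only [hAB, sq_nonneg (D 0 0 1 2)]
  have h6 : D 0 0 1 2 = 0 := by
    refine pow_eq_zero_iff two_ne_zero |>.mp (le_antisymm ?_ (sq_nonneg _))
    linarith only [hAB, sq_nonneg (D 0 0 0 2)]
  exact isTetragonal_of_axis hD h1 h2 h3 h4 h5 h6

lemma isCompact_SO3 : IsCompact {g : Mat3 | IsSO3 g} := by
  have hK : IsCompact (Set.univ.pi fun _ : Fin 3 => Set.univ.pi fun _ : Fin 3 =>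
      Set.Icc (-1 : ℝ) 1) :=
    isCompact_univ_pi fun _ => isCompact_univ_pi fun _ => isCompact_Icc
  refine hK.of_isClosed_subset ?_ fun (g : Mat3) (hg : IsSO3 g) i _ j _ => ?_
  · refine IsClosed.inter (isClosed_eq ?_ continuous_const) (isClosed_eq ?_ continuous_const)
    · exact continuous_id.matrix_mul continuous_id.matrix_transpose
    · exact continuous_id.matrix_det
  · have h : ∑ k, g i k ^ 2 = 1 := by
      simpa [mul_apply, ← sq] using congrFun (congrFun hg.1 i) i
    rw [Set.mem_Icc, ← abs_le, ← sq_le_one_iff_abs_le_one, ← h]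
    exact Finset.single_le_sum (f := fun k => g i k ^ 2) (fun k _ => sq_nonneg _)
      (Finset.mem_univ j)

/-- The third axis maximizes the absolute value of the quartic form of `D` on the sphere. -/
def IsMaxAxis (D : T4) : Prop :=
  ∀ h : Mat3, IsSO3 h → act h D 2 2 2 2 ^ 2 ≤ D 2 2 2 2 ^ 2

lemma exists_isMaxAxis (D : T4) : ∃ g : Mat3, IsSO3 g ∧ IsMaxAxis (act g D) := by
  have hc : Continuous fun g : Mat3 => act g D 2 2 2 2 ^ 2 := by
    unfold act
    fun_prop
  obtain ⟨g, hg, hmax⟩ := isCompact_SO3.exists_isMaxOn ⟨1, by simp [IsSO3]⟩ hc.continuousOn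
  refine ⟨g, hg, fun h hh => ?_⟩
  rw [act_act]
  exact hmax (hh.mul hg)

lemma IsMaxAxis.act {D : T4} (hD : IsMaxAxis D) {g : Mat3} (hg : IsSO3 g)
    (h : _root_.act g D 2 2 2 2 = D 2 2 2 2) : IsMaxAxis (_root_.act g D) := fun k hk => by
  rw [act_act, h]
  exact hD _ (hk.mul hg)

lemma act_rotZ_2222 (c s : ℝ) (D : T4) : act (rotZ c s) D 2 2 2 2 = D 2 2 2 2 := by
  simp [act, rotZ, Fin.sum_univ_three]

/-- The rotation in the plane of the first and third axes. -/
def rotXZ (c s : ℝ) : Mat3 := !![c, 0, -s; 0, 1, 0; s, 0, c]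

/-- The rotation in the plane of the second and third axes. -/
def rotYZ (c s : ℝ) : Mat3 := !![1, 0, 0; 0, c, -s; 0, s, c]

lemma rotXZ_isSO3 {c s : ℝ} (h : c ^ 2 + s ^ 2 = 1) : IsSO3 (rotXZ c s) := by
  constructor
  · ext i j
    fin_cases i <;> fin_cases j <;> simp [rotXZ, mul_apply, Fin.sum_univ_three] <;> grind
  · simp [rotXZ, det_fin_three]
    linarith

lemma rotYZ_isSO3 {c s : ℝ} (h : c ^ 2 + s ^ 2 = 1) : IsSO3 (rotYZ c s) := by
  constructor
  · ext i j
    fin_cases i <;> fin_cases j <;> simp [rotYZ, mul_apply, Fin.sum_univ_three] <;> grind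
  · simp [rotYZ, det_fin_three]
    linarith

lemma exists_cos_sin_of_slope (t : ℝ) : ∃ c : ℝ, c ^ 2 + (t * c) ^ 2 = 1 ∧
    (1 + t ^ 2) ^ 4 * c ^ 8 = 1 := by
  have h : 0 < 1 + t ^ 2 := by positivity
  have hs : √(1 + t ^ 2) ^ 2 = 1 + t ^ 2 := Real.sq_sqrt h.le
  have e : (1 + t ^ 2) * ((√(1 + t ^ 2))⁻¹) ^ 2 = 1 := by
    rw [inv_pow, hs, mul_inv_cancel₀ h.ne']
  refine ⟨(√(1 + t ^ 2))⁻¹, by linear_combination e, ?_⟩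
  calc _ = ((1 + t ^ 2) * ((√(1 + t ^ 2))⁻¹) ^ 2) ^ 4 := by ring
    _ = 1 := by rw [e, one_pow]

lemma IsMaxAxis.le_xz {D : T4} (hD : IsHarm D) (hm : IsMaxAxis D) (t : ℝ) :
    (D 2 2 2 2 + 4 * D 0 2 2 2 * t + 6 * D 0 0 2 2 * t ^ 2 + 4 * D 0 0 0 2 * t ^ 3 +
      D 0 0 0 0 * t ^ 4) ^ 2 ≤ D 2 2 2 2 ^ 2 * (1 + t ^ 2) ^ 4 := by
  obtain ⟨c, hc, h8⟩ := exists_cos_sin_of_slope t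
  have h := hm _ (rotXZ_isSO3 hc)
  have e : _root_.act (rotXZ c (t * c)) D 2 2 2 2 = c ^ 4 * (D 2 2 2 2 + 4 * D 0 2 2 2 * t +
      6 * D 0 0 2 2 * t ^ 2 + 4 * D 0 0 0 2 * t ^ 3 + D 0 0 0 0 * t ^ 4) := by
    obtain ⟨h1, h2, h3, -⟩ := hD
    simp [_root_.act, rotXZ, Fin.sum_univ_three, h1 2 0, h2 _ 2 0, h3 _ _ 2 0]
    ring
  rw [e] at h
  have := mul_le_mul_of_nonneg_right h (by positivity : 0 ≤ (1 + t ^ 2) ^ 4)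
  calc _ = ((1 + t ^ 2) ^ 4 * c ^ 8) * _ := by rw [h8, one_mul]
    _ ≤ _ := by linarith

lemma IsMaxAxis.le_yz {D : T4} (hD : IsHarm D) (hm : IsMaxAxis D) (t : ℝ) :
    (D 2 2 2 2 + 4 * D 1 2 2 2 * t + 6 * D 1 1 2 2 * t ^ 2 + 4 * D 1 1 1 2 * t ^ 3 +
      D 1 1 1 1 * t ^ 4) ^ 2 ≤ D 2 2 2 2 ^ 2 * (1 + t ^ 2) ^ 4 := by
  obtain ⟨c, hc, h8⟩ := exists_cos_sin_of_slope t
  have h := hm _ (rotYZ_isSO3 hc)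
  have e : _root_.act (rotYZ c (t * c)) D 2 2 2 2 = c ^ 4 * (D 2 2 2 2 + 4 * D 1 2 2 2 * t +
      6 * D 1 1 2 2 * t ^ 2 + 4 * D 1 1 1 2 * t ^ 3 + D 1 1 1 1 * t ^ 4) := by
    obtain ⟨h1, h2, h3, -⟩ := hD
    simp [_root_.act, rotYZ, Fin.sum_univ_three, h1 2 1, h2 _ 2 1, h3 _ _ 2 1]
    ring
  rw [e] at h
  have := mul_le_mul_of_nonneg_right h (by positivity : 0 ≤ (1 + t ^ 2) ^ 4)
  calc _ = ((1 + t ^ 2) ^ 4 * c ^ 8) * _ := by rw [h8, one_mul]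
    _ ≤ _ := by linarith

lemma linear_coeff_eq_zero {z p q r w : ℝ} (h : ∀ t : ℝ,
    (z + 4 * p * t + 6 * q * t ^ 2 + 4 * r * t ^ 3 + w * t ^ 4) ^ 2 ≤ z ^ 2 * (1 + t ^ 2) ^ 4) :
    p = 0 := by
  by_cases hz : z = 0
  · have e (t : ℝ) : 4 * p * t + 6 * q * t ^ 2 + 4 * r * t ^ 3 + w * t ^ 4 = 0 := by
      have := h t
      rw [hz] at this
      refine pow_eq_zero_iff two_ne_zero |>.mp (le_antisymm ?_ (sq_nonneg _))
      linarith
    linarith [e 1, e (-1), e 2, e (-2)]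
  · have hmin : IsLocalMin (fun t : ℝ => z ^ 2 * (1 + t ^ 2) ^ 4 -
        (z + 4 * p * t + 6 * q * t ^ 2 + 4 * r * t ^ 3 + w * t ^ 4) ^ 2) 0 :=
      Filter.Eventually.of_forall fun t => by
        have := h t
        simp only
        linarith
    have hf : HasDerivAt (fun t : ℝ => z + 4 * p * t + 6 * q * t ^ 2 + 4 * r * t ^ 3 +
        w * t ^ 4) (4 * p) 0 := by
      have := (((((hasDerivAt_id' (0 : ℝ)).const_mul (4 * p)).const_add z).fun_add
        ((hasDerivAt_pow 2 (0 : ℝ)).const_mul (6 * q))).fun_add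
        ((hasDerivAt_pow 3 (0 : ℝ)).const_mul (4 * r))).fun_add
        ((hasDerivAt_pow 4 (0 : ℝ)).const_mul w)
      simpa using this
    have h0 := hmin.hasDerivAt_eq_zero
      (((((hasDerivAt_pow 2 (0 : ℝ)).const_add 1).fun_pow 4).const_mul (z ^ 2)).fun_sub
        (hf.fun_pow 2))
    norm_num at h0
    grind

lemma eq_zero_of_sq_le {P A : ℝ} (h : 25 * P ^ 2 ≤ 16 * A ^ 2)
    (h1 : (13 * P + 16 * A) ^ 2 ≤ (32 * P) ^ 2) (h2 : (13 * P - 16 * A) ^ 2 ≤ (32 * P) ^ 2) :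
    P = 0 := by
  have e : |5 * P ^ 2| ≤ |4 * (P * A)| := sq_le_sq.mp (by nlinarith [sq_nonneg P])
  rw [abs_of_nonneg (by positivity)] at e
  rcases le_abs.mp e with e | e <;> nlinarith [sq_nonneg P]

lemma isotropic_components {P Q M A B T : ℝ}
    (x1 : (4 * P - Q - M + 4 * A) ^ 2 ≤ 16 * (P + Q) ^ 2)
    (x2 : (4 * P - Q - M - 4 * A) ^ 2 ≤ 16 * (P + Q) ^ 2)
    (y1 : (4 * Q - P - M + 4 * B) ^ 2 ≤ 16 * (P + Q) ^ 2)
    (y2 : (4 * Q - P - M - 4 * B) ^ 2 ≤ 16 * (P + Q) ^ 2)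
    (e01 : T * (P - Q) = 0) (e02 : A * (2 * P - 3 * Q - 4 * M) + 4 * T * B = 0)
    (e12 : 4 * T * A + B * (4 * M + 3 * P - 2 * Q) = 0)
    (e11 : (P - Q) * (M + 2 * (P + Q)) = 0)
    (e22 : (M + P) ^ 2 + 3 * M ^ 2 + 3 * P ^ 2 + 6 * A ^ 2 + 6 * B ^ 2 + 4 * T ^ 2 =
      4 * A ^ 2 + 4 * B ^ 2 + 3 * P ^ 2 + 3 * Q ^ 2 + (P + Q) ^ 2) :
    P = Q ∧ A = 0 ∧ B = 0 := by
  rcases eq_or_ne P Q with rfl | hPQ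
  · refine ⟨rfl, ?_⟩
    by_cases hK : (4 * M + P) ^ 2 + (4 * T) ^ 2 = 0
    · have hM : 4 * M + P = 0 := by nlinarith
      have hT : T = 0 := by nlinarith
      obtain rfl : M = -P / 4 := by linarith
      subst hT
      have hS : 8 * (A ^ 2 + B ^ 2) = 25 * P ^ 2 := by linarith
      have hP : P = 0 := by
        rcases le_total (B ^ 2) (A ^ 2) with hAB | hAB
        · exact eq_zero_of_sq_le (A := A) (by linarith) (by linarith) (by linarith)
        · exact eq_zero_of_sq_le (A := B) (by linarith) (by linarith) (by linarith)
      subst hP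
      constructor <;> nlinarith
    · constructor <;> refine (mul_eq_zero.mp ?_).resolve_left hK
      · linear_combination 4 * T * e12 - (4 * M + P) * e02
      · linear_combination (4 * M + P) * e12 + 4 * T * e02
  · have hPQ' := sub_ne_zero.mpr hPQ
    obtain rfl : T = 0 := (mul_eq_zero.mp e01).resolve_right hPQ'
    obtain rfl : M = -(2 * (P + Q)) := by linarith [(mul_eq_zero.mp e11).resolve_left hPQ']
    have hA : A = 0 := by
      by_contra hA
      have : Q = -(2 * P) := by
        refine mul_left_cancel₀ hA ?_
        linear_combination e02 / 5
      subst this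
      exact hA (by nlinarith)
    have hB : B = 0 := by
      by_contra hB
      have : P = -(2 * Q) := by
        refine mul_left_cancel₀ hB ?_
        linear_combination -e12 / 5
      subst this
      exact hB (by nlinarith)
    subst hA hB
    have hz : (2 * P + 3 * Q) * (3 * P + 2 * Q) = 0 := by linear_combination e22 / 2
    exfalso
    refine hPQ ?_
    rcases mul_eq_zero.mp hz with h | h
    · obtain rfl : Q = -(2 / 3 * P) := by linarith
      have : P = 0 := by nlinarith
      rw [this]; norm_num
    · obtain rfl : P = -(2 / 3 * Q) := by linarith
      have : Q = 0 := by nlinarith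
      rw [this]; norm_num

/-- A harmonic tensor whose covariant `d2` is isotropic and whose third axis maximizes the quartic
form is tetragonal, once the rotation about that axis has been used to remove `D 0 1 2 2`. -/
lemma isTetragonal_of_isMaxAxis {D : T4} {a : ℝ} (hD : IsHarm D) (hm : IsMaxAxis D)
    (h3 : D 0 1 2 2 = 0) (hd : d2 D = diagonal ![a, a, a]) : IsTetragonal D := by
  have h1 := linear_coeff_eq_zero (hm.le_xz hD)
  have h2 := linear_coeff_eq_zero (hm.le_yz hD)
  have x1 := hm.le_xz hD 1
  have x2 := hm.le_xz hD (-1)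
  have y1 := hm.le_yz hD 1
  have y2 := hm.le_yz hD (-1)
  have e00 := d2_eq hD 0 0
  have e11 := d2_eq hD 1 1
  have e22 := d2_eq hD 2 2
  have e01 := d2_eq hD 0 1
  have e02 := d2_eq hD 0 2
  have e12 := d2_eq hD 1 2
  have hD' := hD
  obtain ⟨a1, a2, a3, -⟩ := hD'
  obtain ⟨t1, t2, t3, t4, t5, t6⟩ := hD.trace_eqs
  rw [hd] at e00 e11 e22 e01 e02 e12
  simp [a1 1 0, a1 2 1, a1 2 0, a2 _ 1 0, a2 _ 2 0, a2 _ 2 1, a3 _ _ 1 0, a3 _ _ 2 0, a3 _ _ 2 1,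
    h1, h2, h3, t1, t2, t3, t4, t5, t6] at e00 e11 e22 e01 e02 e12
  rw [t1, t3, h1] at x1 x2
  rw [t2, t3, t6, h2] at y1 y2
  have key : D 0 0 2 2 = D 1 1 2 2 ∧ D 0 0 0 2 = 0 ∧ D 0 0 1 2 = 0 :=
    isotropic_components (M := D 0 0 1 1) (T := D 0 0 0 1) (by linarith) (by linarith)
      (by linarith) (by linarith) (by linarith) (by linarith) (by linarith) (by linarith)
      (by linarith)
  exact isTetragonal_of_axis hD h1 h2 h3 key.1 key.2.1 key.2.2

lemma isTetragonal_of_isotropic {D : T4} {a : ℝ} (hD : IsHarm D)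
    (hd : d2 D = diagonal ![a, a, a]) : IsTetragonal D := by
  have ha : d2 D = a • (1 : Mat3) := by
    rw [hd, smul_one_eq_diagonal]
    congr 1
    ext i
    fin_cases i <;> rfl
  have hinv {g : Mat3} (hg : IsSO3 g) {E : T4} (hE : d2 E = a • (1 : Mat3)) :
      d2 (act g E) = a • (1 : Mat3) := by
    rw [d2_act hg.transpose_mul, hE, Matrix.mul_smul, Matrix.mul_one, Matrix.smul_mul, hg.1]
  obtain ⟨g, hg, hm⟩ := exists_isMaxAxis D
  refine IsTetragonal.of_act hg ?_
  have hE := hD.act hg.transpose_mul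
  have hdE := hinv hg ha
  generalize act g D = E at hE hm hdE
  obtain ⟨c, s, hcs, h, -⟩ := exists_double_angle ((E 0 0 2 2 - E 1 1 2 2) / 2) (E 0 1 2 2)
  have hr := rotZ_isSO3 hcs
  refine IsTetragonal.of_act hr (isTetragonal_of_isMaxAxis (a := a)
    (hE.act hr.transpose_mul) (hm.act hr (act_rotZ_2222 c s E)) ?_ ?_)
  · obtain ⟨h1, h2, h3, -⟩ := hE
    simp [act, rotZ, Fin.sum_univ_three, h1 1 0]
    linear_combination h
  · rw [hinv hr hdE, smul_one_eq_diagonal]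
    congr 1
    ext i
    fin_cases i <;> rfl

lemma discriminant_relation {x y u v w : ℝ} (r1 : 6 * w = -3 * x ^ 3 + 9 * x * u + 20 * y ^ 2)
    (r3 : 6 * u ^ 2 = -3 * x ^ 4 + 9 * x ^ 2 * u + 20 * x * y ^ 2 - 20 * y * v)
    (r5 : 3 * u * v = 7 * x ^ 3 * y - 15 * x * y * u + 3 * x ^ 2 * v - 60 * y ^ 3) :
    (u - x ^ 2 / 3) ^ 3 = 6 * (w - x * u + 2 / 9 * x ^ 3) ^ 2 := by
  obtain rfl : w = (-3 * x ^ 3 + 9 * x * u + 20 * y ^ 2) / 6 := by linarith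
  linear_combination (u - x ^ 2) / 6 * r3 - 10 / 9 * y * r5

lemma isTetragonal_of_syzygies {D : T4} (hD : IsHarm D)
    (r1 : 6 * J6 D = -3 * (J2 D) ^ 3 + 9 * J2 D * J4 D + 20 * (J3 D) ^ 2)
    (r3 : 6 * (J4 D) ^ 2 = -3 * (J2 D) ^ 4 + 9 * (J2 D) ^ 2 * J4 D +
      20 * J2 D * (J3 D) ^ 2 - 20 * J3 D * J5 D)
    (r4 : 5 * J8 D = -3 * (J2 D) ^ 4 + 6 * (J2 D) ^ 2 * J4 D +
      30 * J2 D * (J3 D) ^ 2 - 5 * J3 D * J5 D)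
    (r5 : 3 * J4 D * J5 D = 7 * (J2 D) ^ 3 * J3 D - 15 * J2 D * J3 D * J4 D +
      3 * (J2 D) ^ 2 * J5 D - 60 * (J3 D) ^ 3)
    (r7 : 5 * (J5 D) ^ 2 = -2 * (J2 D) ^ 5 + 4 * (J2 D) ^ 3 * J4 D +
      10 * (J2 D) ^ 2 * (J3 D) ^ 2 - 20 * J2 D * J3 D * J5 D + 30 * (J3 D) ^ 2 * J4 D) :
    IsTetragonal D := by
  obtain ⟨g, a, b, hg, hd⟩ := exists_act_d2_uniaxial hD (discriminant_relation r1 r3 r5)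
  have hg' := hg.transpose_mul
  refine IsTetragonal.of_act hg ?_
  rcases eq_or_ne a b with rfl | hab
  · exact isTetragonal_of_isotropic (hD.act hg') hd
  · rw [← J2_act hg', ← J3_act hg', ← J4_act hg'] at r1 r3 r4 r7
    rw [← J5_act hg'] at r3 r4 r7
    rw [← J6_act hg'] at r1
    rw [← J8_act hg'] at r4
    exact isTetragonal_of_relations (hD.act hg') hd hab r1 r3 r4 r7

lemma exists_isTetragonal_iff {D : T4} :
    (∃ (g : Mat3) (δ σ : ℝ), IsSO3 g ∧ act g D = NFtetra δ σ) ↔ IsTetragonal D := by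
  refine ⟨fun ⟨g, δ, σ, hg, e⟩ => .of_act hg ?_, fun ⟨g, δ, σ, hg, e, _⟩ => ⟨g, δ, σ, hg, e⟩⟩
  rw [e]
  exact isTetragonal_of_axis (NFtetra_isHarm δ σ) (by simp +decide [NFtetra, symT])
    (by simp +decide [NFtetra, symT]) (by simp +decide [NFtetra, symT])
    (by simp +decide [NFtetra, symT]) (by simp +decide [NFtetra, symT])
    (by simp +decide [NFtetra, symT])

/-- The fundamental invariants of the tetragonal normal form. -/
lemma invariants_NFtetra (δ σ : ℝ) {a b : ℝ} (ha : a = 60 * δ ^ 2 + 4 * σ ^ 2)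
    (hb : b = 160 * δ ^ 2) :
    J2 (NFtetra δ σ) = 2 * a + b ∧ J3 (NFtetra δ σ) = 12 * δ * a ∧
    J4 (NFtetra δ σ) = 2 * a ^ 2 + b ^ 2 ∧ J5 (NFtetra δ σ) = 8 * δ * (b - a) ^ 2 ∧
    J6 (NFtetra δ σ) = 2 * a ^ 3 + b ^ 3 ∧
    J7 (NFtetra δ σ) = 8 * δ * (b - a) ^ 2 * (a + b) ∧
    J8 (NFtetra δ σ) = 96 * δ ^ 2 * (b - a) ^ 2 * (a + b) ∧
    J9 (NFtetra δ σ) = 8 * δ * (b - a) ^ 2 * (a + b) ^ 2 ∧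
    J10 (NFtetra δ σ) = 96 * δ ^ 2 * (b - a) ^ 2 * (a + b) ^ 2 := by
  have hd := d2_NFtetra δ σ
  rw [← ha, ← hb] at hd
  have hD := NFtetra_isHarm δ σ
  have c1 : NFtetra δ σ 2 2 2 2 = 8 * δ := by simp +decide [NFtetra, symT]
  have c2 : NFtetra δ σ 0 0 2 2 = -(4 * δ) := by simp +decide [NFtetra, symT]
  have c3 : NFtetra δ σ 1 1 2 2 = -(4 * δ) := by simp +decide [NFtetra, symT]
  have c4 : NFtetra δ σ 0 1 2 2 = 0 := by simp +decide [NFtetra, symT]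
  have c5 : NFtetra δ σ 0 2 2 2 = 0 := by simp +decide [NFtetra, symT]
  have c6 : NFtetra δ σ 1 2 2 2 = 0 := by simp +decide [NFtetra, symT]
  rw [J2_of_diagonal hd, J3_NFtetra, J4_of_diagonal hd, J5_of_diagonal hD hd, J6_of_diagonal hd,
    J7_of_diagonal hD hd, J8_of_diagonal hD hd, J9_of_diagonal hD hd, J10_of_diagonal hD hd, c1,
    c2, c3, c4, c5, c6, ← ha]
  refine ⟨?_, ?_, ?_, ?_, ?_, ?_, ?_, ?_, ?_⟩ <;> ring

lemma invariants_of_act_eq_NFtetra {D : T4} {g : Mat3} {δ σ : ℝ} (hg : IsSO3 g)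
    (e : act g D = NFtetra δ σ) {a b : ℝ} (ha : a = 60 * δ ^ 2 + 4 * σ ^ 2)
    (hb : b = 160 * δ ^ 2) :
    J2 D = 2 * a + b ∧ J3 D = 12 * δ * a ∧ J4 D = 2 * a ^ 2 + b ^ 2 ∧
    J5 D = 8 * δ * (b - a) ^ 2 ∧ J6 D = 2 * a ^ 3 + b ^ 3 ∧
    J7 D = 8 * δ * (b - a) ^ 2 * (a + b) ∧ J8 D = 96 * δ ^ 2 * (b - a) ^ 2 * (a + b) ∧
    J9 D = 8 * δ * (b - a) ^ 2 * (a + b) ^ 2 ∧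
    J10 D = 96 * δ ^ 2 * (b - a) ^ 2 * (a + b) ^ 2 := by
  have hg' := hg.transpose_mul
  rw [← J2_act hg', ← J3_act hg', ← J4_act hg', ← J5_act hg', ← J6_act hg', ← J7_act hg',
    ← J8_act hg', ← J9_act hg', ← J10_act hg', e]
  exact invariants_NFtetra δ σ ha hb

/-- a harmonic tensor `D ∈ H⁴` lies in the closed tetragonal stratum iff its
fundamental invariants satisfy the eight listed syzygies together with the inequality
`2J₂(J₂² − 3J₄)² − 35J₅² ≥ 0`; moreover, if also `3J₄ − J₂² ≠ 0` and
`5J₂³ − 8J₂J₄ − 70J₃² ≠ 0`, then `g, δ, σ` can be chosen with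
`δ = −J₅/(4(J₂² − 3J₄))`, `σ ≥ 0` and `J₂ = 8σ² + 280δ²`. -/
theorem tetragonal_stratum_characterization (D : T4) (hD : IsHarm D) :
    ((∃ (g : Mat3) (δ σ : ℝ), IsSO3 g ∧ act g D = NFtetra δ σ) ↔
      (6 * J6 D = -3 * (J2 D) ^ 3 + 9 * J2 D * J4 D + 20 * (J3 D) ^ 2 ∧
       3 * J7 D = (J2 D) ^ 2 * J3 D - 3 * J3 D * J4 D + 3 * J2 D * J5 D ∧
       6 * (J4 D) ^ 2 = -3 * (J2 D) ^ 4 + 9 * (J2 D) ^ 2 * J4 D +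
         20 * J2 D * (J3 D) ^ 2 - 20 * J3 D * J5 D ∧
       5 * J8 D = -3 * (J2 D) ^ 4 + 6 * (J2 D) ^ 2 * J4 D +
         30 * J2 D * (J3 D) ^ 2 - 5 * J3 D * J5 D ∧
       3 * J4 D * J5 D = 7 * (J2 D) ^ 3 * J3 D - 15 * J2 D * J3 D * J4 D +
         3 * (J2 D) ^ 2 * J5 D - 60 * (J3 D) ^ 3 ∧
       6 * J9 D = 5 * (J2 D) ^ 3 * J3 D - 13 * J2 D * J3 D * J4 D +
         6 * (J2 D) ^ 2 * J5 D - 20 * (J3 D) ^ 3 ∧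
       5 * (J5 D) ^ 2 = -2 * (J2 D) ^ 5 + 4 * (J2 D) ^ 3 * J4 D +
         10 * (J2 D) ^ 2 * (J3 D) ^ 2 - 20 * J2 D * J3 D * J5 D +
         30 * (J3 D) ^ 2 * J4 D ∧
       15 * J10 D = -9 * (J2 D) ^ 5 + 18 * (J2 D) ^ 3 * J4 D +
         85 * (J2 D) ^ 2 * (J3 D) ^ 2 - 30 * J2 D * J3 D * J5 D +
         15 * (J3 D) ^ 2 * J4 D ∧
       2 * J2 D * ((J2 D) ^ 2 - 3 * J4 D) ^ 2 - 35 * (J5 D) ^ 2 ≥ 0)) ∧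
    ((∃ (g : Mat3) (δ σ : ℝ), IsSO3 g ∧ act g D = NFtetra δ σ) →
      3 * J4 D - (J2 D) ^ 2 ≠ 0 →
      5 * (J2 D) ^ 3 - 8 * J2 D * J4 D - 70 * (J3 D) ^ 2 ≠ 0 →
      ∃ (g : Mat3) (δ σ : ℝ), IsSO3 g ∧ act g D = NFtetra δ σ ∧
        δ = -J5 D / (4 * ((J2 D) ^ 2 - 3 * J4 D)) ∧ σ ≥ 0 ∧
        J2 D = 8 * σ ^ 2 + 280 * δ ^ 2) := by
  refine ⟨⟨?_, ?_⟩, ?_⟩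
  · rintro ⟨g, δ, σ, hg, e⟩
    obtain ⟨j2, j3, j4, j5, j6, j7, j8, j9, j10⟩ := invariants_of_act_eq_NFtetra hg e rfl rfl
    refine ⟨?_, ?_, ?_, ?_, ?_, ?_, ?_, ?_, ?_⟩
    all_goals simp only [j2, j3, j4, j5, j6, j7, j8, j9, j10]
    on_goal 9 =>
      have h : 0 ≤ (8 * σ * (160 * δ ^ 2 - (60 * δ ^ 2 + 4 * σ ^ 2)) ^ 2) ^ 2 := sq_nonneg _
      linarith
    all_goals ring
  · rintro ⟨r1, -, r3, r4, r5, -, r7, -, -⟩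
    exact (exists_isTetragonal_iff).mpr (isTetragonal_of_syzygies hD r1 r3 r4 r5 r7)
  · intro H hne _
    obtain ⟨g, δ, σ, hg, e, hσ⟩ := (exists_isTetragonal_iff).mp H
    obtain ⟨j2, -, j4, j5, -⟩ := invariants_of_act_eq_NFtetra hg e rfl rfl
    refine ⟨g, δ, σ, hg, e, ?_, hσ, by rw [j2]; ring⟩
    have hne' : 4 * (J2 D ^ 2 - 3 * J4 D) ≠ 0 := fun h => hne (by linarith)
    rw [eq_div_iff hne', j5, j2, j4]
    ring
end

section
/- For every D ∈ H⁴, the characteristic polynomial of its Kelvin matrix 𝐃 ∈ Matrix (Fin 6) (Fin 6) ℝ is given in terms of the fundamental invariants by χ(X) = X⁶ − (J₂/2)·X⁴ − (J₃/3)·X³ + ((J₂² − 2J₄)/5)·X² + ((2/25)(J₂J₃ − 3J₅))·X. In particular 0 is always an eigenvalue of 𝐃, and all coefficients of the characteristic polynomial are SO(3)-invariants of D expressible in J₂, J₃, J₄, J₅. -/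
open Matrix BigOperators

/-- The Kelvin index pairs `p₁=(1,1), p₂=(2,2), p₃=(3,3), p₄=(2,3), p₅=(1,3), p₆=(1,2)`
(0-based). -/
def kidx : Fin 6 → Fin 3 × Fin 3 := ![(0, 0), (1, 1), (2, 2), (1, 2), (0, 2), (0, 1)]

/-- The Kelvin weights: `1` on the first three indices, `√2` on the last three. -/
noncomputable def kw : Fin 6 → ℝ := ![1, 1, 1, Real.sqrt 2, Real.sqrt 2, Real.sqrt 2]

/-- The Kelvin (6×6) matrix of a fourth-order tensor. -/
noncomputable def kelvin (D : T4) : Matrix (Fin 6) (Fin 6) ℝ :=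
  Matrix.of fun m n => kw m * kw n * D (kidx m).1 (kidx m).2 (kidx n).1 (kidx n).2

/-- The Kelvin matrix without its weights. -/
noncomputable def pairMatrix (D : T4) : Matrix (Fin 6) (Fin 6) ℝ :=
  Matrix.of fun m n => D (kidx m).1 (kidx m).2 (kidx n).1 (kidx n).2

lemma kelvin_charpoly_eq_pairMatrix (D : T4) :
    (kelvin D).charpoly = (pairMatrix D * diagonal ![1, 1, 1, 2, 2, 2]).charpoly := by
  have hk : kelvin D = diagonal kw * (pairMatrix D * diagonal kw) := by
    ext m n
    simp [kelvin, pairMatrix]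
    ring
  have hw : diagonal kw * diagonal kw = diagonal ![1, 1, 1, 2, 2, (2 : ℝ)] := by
    rw [diagonal_mul_diagonal]
    congr 1
    ext m
    fin_cases m <;> simp [kw]
  rw [hk, charpoly_mul_comm, Matrix.mul_assoc, hw]

/-- If the first three rows of `A` add up to `(t, t, t, 0, 0, 0)`, then `det A` is `t` times a
`5 × 5` determinant. -/
lemma det_eq_mul_det_of_row_sum (A : Matrix (Fin 6) (Fin 6) ℝ) (t : ℝ)
    (h : ∀ j, A 0 j + A 1 j + A 2 j = ![t, t, t, 0, 0, 0] j) :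
    A.det = t * (Matrix.of fun i j : Fin 5 =>
      A i.succ j.succ - if j < 2 then A i.succ 0 else 0).det := by
  let U : Matrix (Fin 6) (Fin 6) ℝ :=
    !![1, 1, 1, 0, 0, 0; 0, 1, 0, 0, 0, 0; 0, 0, 1, 0, 0, 0;
       0, 0, 0, 1, 0, 0; 0, 0, 0, 0, 1, 0; 0, 0, 0, 0, 0, 1]
  let V : Matrix (Fin 6) (Fin 6) ℝ :=
    !![1, -1, -1, 0, 0, 0; 0, 1, 0, 0, 0, 0; 0, 0, 1, 0, 0, 0;
       0, 0, 0, 1, 0, 0; 0, 0, 0, 0, 1, 0; 0, 0, 0, 0, 0, 1]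
  have hU : U.det = 1 := by
    simp [U, det_succ_column_zero, Fin.sum_univ_succ]
  have hV : V.det = 1 := by
    simp [V, det_succ_column_zero, Fin.sum_univ_succ]
  have hrow : ∀ j, (U * A * V) 0 j = if j = 0 then t else 0 := by
    intro j
    have hUA : ∀ k, (U * A) 0 k = ![t, t, t, 0, 0, 0] k := fun k => by
      rw [← h k]
      simp [U, Matrix.mul_apply, Fin.sum_univ_six]
    rw [Matrix.mul_apply]
    simp only [hUA]
    fin_cases j <;> simp [V, Fin.sum_univ_six]
  have hsub : (U * A * V).submatrix Fin.succ Fin.succ = Matrix.of fun i j : Fin 5 =>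
      A i.succ j.succ - if j < 2 then A i.succ 0 else 0 := by
    have hUA : ∀ (i : Fin 5) k, (U * A) i.succ k = A i.succ k := fun i k => by
      fin_cases i <;> simp [U, Matrix.mul_apply, Fin.sum_univ_six]
    ext i j
    rw [submatrix_apply, Matrix.mul_apply, of_apply]
    simp only [hUA]
    fin_cases j <;> simp [V, Fin.sum_univ_six] <;> ring
  have hdet : A.det = (U * A * V).det := by rw [det_mul, det_mul, hU, hV]; ring
  rw [hdet, det_succ_row_zero, Fin.sum_univ_succ]
  simp [hrow, hsub]

lemma det_fin_four_laplace (A : Matrix (Fin 4) (Fin 4) ℝ) :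
    A.det = A 0 0 * (A.submatrix ![1, 2, 3] ![1, 2, 3]).det -
      A 0 1 * (A.submatrix ![1, 2, 3] ![0, 2, 3]).det +
      A 0 2 * (A.submatrix ![1, 2, 3] ![0, 1, 3]).det -
      A 0 3 * (A.submatrix ![1, 2, 3] ![0, 1, 2]).det := by
  rw [det_succ_row_zero, Fin.sum_univ_four]
  have h0 : (Fin.succ : Fin 3 → Fin 4) = ![1, 2, 3] := by decide
  have h1 : Fin.succAbove (0 : Fin 4) = ![1, 2, 3] := by decide
  have h2 : Fin.succAbove (1 : Fin 4) = ![0, 2, 3] := by decide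
  have h3 : Fin.succAbove (2 : Fin 4) = ![0, 1, 3] := by decide
  have h4 : Fin.succAbove (3 : Fin 4) = ![0, 1, 2] := by decide
  rw [h0, h1, h2, h3, h4]
  simp only [Fin.val_zero, Fin.val_one, Fin.val_two, show ((3 : Fin 4) : ℕ) = 3 from rfl]
  ring

lemma det_fin_five_laplace (A : Matrix (Fin 5) (Fin 5) ℝ) :
    A.det = A 0 0 * (A.submatrix ![1, 2, 3, 4] ![1, 2, 3, 4]).det -
      A 0 1 * (A.submatrix ![1, 2, 3, 4] ![0, 2, 3, 4]).det +
      A 0 2 * (A.submatrix ![1, 2, 3, 4] ![0, 1, 3, 4]).det -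
      A 0 3 * (A.submatrix ![1, 2, 3, 4] ![0, 1, 2, 4]).det +
      A 0 4 * (A.submatrix ![1, 2, 3, 4] ![0, 1, 2, 3]).det := by
  rw [det_succ_row_zero, Fin.sum_univ_five]
  have h0 : (Fin.succ : Fin 4 → Fin 5) = ![1, 2, 3, 4] := by decide
  have h1 : Fin.succAbove (0 : Fin 5) = ![1, 2, 3, 4] := by decide
  have h2 : Fin.succAbove (1 : Fin 5) = ![0, 2, 3, 4] := by decide
  have h3 : Fin.succAbove (2 : Fin 5) = ![0, 1, 3, 4] := by decide
  have h4 : Fin.succAbove (3 : Fin 5) = ![0, 1, 2, 4] := by decide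
  have h5 : Fin.succAbove (4 : Fin 5) = ![0, 1, 2, 3] := by decide
  rw [h0, h1, h2, h3, h4, h5]
  simp only [Fin.val_zero, Fin.val_one, Fin.val_two, show ((3 : Fin 5) : ℕ) = 3 from rfl,
    show ((4 : Fin 5) : ℕ) = 4 from rfl]
  ring

/-- The nine independent components of a harmonic fourth-order tensor. -/
structure HasCoords (D : T4) (x y z a₁ a₂ b₁ b₂ c₁ c₂ : ℝ) : Prop where
  swap₁ : ∀ i j k l, D i j k l = D j i k l
  swap₂ : ∀ i j k l, D i j k l = D i k j l
  swap₃ : ∀ i j k l, D i j k l = D i j l k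
  c0000 : D 0 0 0 0 = -x - y
  c1111 : D 1 1 1 1 = -x - z
  c2222 : D 2 2 2 2 = -y - z
  c0011 : D 0 0 1 1 = x
  c0022 : D 0 0 2 2 = y
  c1122 : D 1 1 2 2 = z
  c0012 : D 0 0 1 2 = -a₁ - a₂
  c1112 : D 1 1 1 2 = a₁
  c1222 : D 1 2 2 2 = a₂
  c0112 : D 0 1 1 2 = -b₁ - b₂
  c0002 : D 0 0 0 2 = b₁
  c0222 : D 0 2 2 2 = b₂
  c0122 : D 0 1 2 2 = -c₁ - c₂
  c0001 : D 0 0 0 1 = c₁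
  c0111 : D 0 1 1 1 = c₂

lemma IsHarm.hasCoords {D : T4} (hD : IsHarm D) :
    HasCoords D (D 0 0 1 1) (D 0 0 2 2) (D 1 1 2 2) (D 1 1 1 2) (D 1 2 2 2) (D 0 0 0 2)
      (D 0 2 2 2) (D 0 0 0 1) (D 0 1 1 1) := by
  obtain ⟨h₁, h₂, h₃, h₄⟩ := hD
  have e₀₀ := h₄ 0 0
  have e₁₁ := h₄ 1 1
  have e₂₂ := h₄ 2 2
  have e₁₂ := h₄ 1 2
  have e₀₂ := h₄ 0 2
  have e₀₁ := h₄ 0 1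
  simp only [Fin.sum_univ_three, h₁ 1 0, h₁ 2 0, h₁ 2 1, h₂ _ 1 0, h₂ _ 2 0, h₂ _ 2 1,
    h₃ _ _ 1 0, h₃ _ _ 2 0, h₃ _ _ 2 1] at e₀₀ e₁₁ e₂₂ e₁₂ e₀₂ e₀₁
  refine ⟨h₁, h₂, h₃, ?_, ?_, ?_, rfl, rfl, rfl, ?_, rfl, rfl, ?_, rfl, rfl, ?_, rfl, rfl⟩ <;>
    linarith

namespace HasCoords

set_option linter.unusedSimpArgs false

variable {D : T4} {x y z a₁ a₂ b₁ b₂ c₁ c₂ : ℝ}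

lemma d2_00 (h : HasCoords D x y z a₁ a₂ b₁ b₂ c₁ c₂) : d2 D 0 0 =
    4 * x ^ 2 + 2 * x * y + 4 * y ^ 2 + 6 * a₁ ^ 2 + 12 * a₁ * a₂ + 6 * a₂ ^ 2 + 6 * b₁ ^ 2 +
    6 * b₁ * b₂ + 4 * b₂ ^ 2 + 6 * c₁ ^ 2 + 6 * c₁ * c₂ + 4 * c₂ ^ 2 := by
  simp only [d2, sqT, of_apply, Fin.sum_univ_three, h.swap₁ 1 0, h.swap₁ 2 0, h.swap₁ 2 1,
    h.swap₂ _ 1 0, h.swap₂ _ 2 0, h.swap₂ _ 2 1, h.swap₃ _ _ 1 0, h.swap₃ _ _ 2 0, h.swap₃ _ _ 2 1,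
    h.c0000, h.c1111, h.c2222, h.c0011, h.c0022, h.c1122, h.c0012, h.c1112, h.c1222, h.c0112,
    h.c0002, h.c0222, h.c0122, h.c0001, h.c0111]
  ring

lemma d2_01 (h : HasCoords D x y z a₁ a₂ b₁ b₂ c₁ c₂) : d2 D 0 1 =
    2 * x * c₁ + 2 * x * c₂ - 4 * y * c₁ - 3 * y * c₂ - 3 * z * c₁ - 4 * z * c₂ + 3 * a₁ * b₂ +
    3 * a₂ * b₁ + 7 * a₂ * b₂ := by
  simp only [d2, sqT, of_apply, Fin.sum_univ_three, h.swap₁ 1 0, h.swap₁ 2 0, h.swap₁ 2 1,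
    h.swap₂ _ 1 0, h.swap₂ _ 2 0, h.swap₂ _ 2 1, h.swap₃ _ _ 1 0, h.swap₃ _ _ 2 0, h.swap₃ _ _ 2 1,
    h.c0000, h.c1111, h.c2222, h.c0011, h.c0022, h.c1122, h.c0012, h.c1112, h.c1222, h.c0112,
    h.c0002, h.c0222, h.c0122, h.c0001, h.c0111]
  ring

lemma d2_02 (h : HasCoords D x y z a₁ a₂ b₁ b₂ c₁ c₂) : d2 D 0 2 =
    -4 * x * b₁ - 3 * x * b₂ + 2 * y * b₁ + 2 * y * b₂ - 3 * z * b₁ - 4 * z * b₂ + 3 * a₁ * c₁ +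
    7 * a₁ * c₂ + 3 * a₂ * c₂ := by
  simp only [d2, sqT, of_apply, Fin.sum_univ_three, h.swap₁ 1 0, h.swap₁ 2 0, h.swap₁ 2 1,
    h.swap₂ _ 1 0, h.swap₂ _ 2 0, h.swap₂ _ 2 1, h.swap₃ _ _ 1 0, h.swap₃ _ _ 2 0, h.swap₃ _ _ 2 1,
    h.c0000, h.c1111, h.c2222, h.c0011, h.c0022, h.c1122, h.c0012, h.c1112, h.c1222, h.c0112,
    h.c0002, h.c0222, h.c0122, h.c0001, h.c0111]
  ring

lemma d2_11 (h : HasCoords D x y z a₁ a₂ b₁ b₂ c₁ c₂) : d2 D 1 1 =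
    4 * x ^ 2 + 2 * x * z + 4 * z ^ 2 + 6 * a₁ ^ 2 + 6 * a₁ * a₂ + 4 * a₂ ^ 2 + 6 * b₁ ^ 2 +
    12 * b₁ * b₂ + 6 * b₂ ^ 2 + 4 * c₁ ^ 2 + 6 * c₁ * c₂ + 6 * c₂ ^ 2 := by
  simp only [d2, sqT, of_apply, Fin.sum_univ_three, h.swap₁ 1 0, h.swap₁ 2 0, h.swap₁ 2 1,
    h.swap₂ _ 1 0, h.swap₂ _ 2 0, h.swap₂ _ 2 1, h.swap₃ _ _ 1 0, h.swap₃ _ _ 2 0, h.swap₃ _ _ 2 1,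
    h.c0000, h.c1111, h.c2222, h.c0011, h.c0022, h.c1122, h.c0012, h.c1112, h.c1222, h.c0112,
    h.c0002, h.c0222, h.c0122, h.c0001, h.c0111]
  ring

lemma d2_12 (h : HasCoords D x y z a₁ a₂ b₁ b₂ c₁ c₂) : d2 D 1 2 =
    -4 * x * a₁ - 3 * x * a₂ - 3 * y * a₁ - 4 * y * a₂ + 2 * z * a₁ + 2 * z * a₂ + 7 * b₁ * c₁ +
    3 * b₁ * c₂ + 3 * b₂ * c₁ := by
  simp only [d2, sqT, of_apply, Fin.sum_univ_three, h.swap₁ 1 0, h.swap₁ 2 0, h.swap₁ 2 1,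
    h.swap₂ _ 1 0, h.swap₂ _ 2 0, h.swap₂ _ 2 1, h.swap₃ _ _ 1 0, h.swap₃ _ _ 2 0, h.swap₃ _ _ 2 1,
    h.c0000, h.c1111, h.c2222, h.c0011, h.c0022, h.c1122, h.c0012, h.c1112, h.c1222, h.c0112,
    h.c0002, h.c0222, h.c0122, h.c0001, h.c0111]
  ring

lemma d2_22 (h : HasCoords D x y z a₁ a₂ b₁ b₂ c₁ c₂) : d2 D 2 2 =
    4 * y ^ 2 + 2 * y * z + 4 * z ^ 2 + 4 * a₁ ^ 2 + 6 * a₁ * a₂ + 6 * a₂ ^ 2 + 4 * b₁ ^ 2 +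
    6 * b₁ * b₂ + 6 * b₂ ^ 2 + 6 * c₁ ^ 2 + 12 * c₁ * c₂ + 6 * c₂ ^ 2 := by
  simp only [d2, sqT, of_apply, Fin.sum_univ_three, h.swap₁ 1 0, h.swap₁ 2 0, h.swap₁ 2 1,
    h.swap₂ _ 1 0, h.swap₂ _ 2 0, h.swap₂ _ 2 1, h.swap₃ _ _ 1 0, h.swap₃ _ _ 2 0, h.swap₃ _ _ 2 1,
    h.c0000, h.c1111, h.c2222, h.c0011, h.c0022, h.c1122, h.c0012, h.c1112, h.c1222, h.c0112,
    h.c0002, h.c0222, h.c0122, h.c0001, h.c0111]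
  ring

lemma J3_eq (h : HasCoords D x y z a₁ a₂ b₁ b₂ c₁ c₂) : J3 D =
    6 * (3 * (x * a₂ ^ 2 + x * b₂ ^ 2 + x * (c₁ + c₂) ^ 2 + y * a₁ ^ 2 + y * (b₁ + b₂) ^ 2 +
      y * c₂ ^ 2 + z * (a₁ + a₂) ^ 2 + z * b₁ ^ 2 + z * c₁ ^ 2) +
      4 * (x * a₁ * a₂ + x * b₁ * b₂ + y * a₁ * a₂ + y * c₁ * c₂ + z * b₁ * b₂ + z * c₁ * c₂ +
      a₁ * b₂ * c₁ + a₂ * b₁ * c₂) + x * y * z -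
      (x ^ 2 * y + x ^ 2 * z + x * y ^ 2 + x * z ^ 2 + y ^ 2 * z + y * z ^ 2)) := by
  simp only [J3, d3, trace, diag, cbT, sqT, of_apply, Fin.sum_univ_three, h.swap₁ 1 0, h.swap₁ 2 0, h.swap₁ 2 1,
    h.swap₂ _ 1 0, h.swap₂ _ 2 0, h.swap₂ _ 2 1, h.swap₃ _ _ 1 0, h.swap₃ _ _ 2 0, h.swap₃ _ _ 2 1,
    h.c0000, h.c1111, h.c2222, h.c0011, h.c0022, h.c1122, h.c0012, h.c1112, h.c1222, h.c0112,
    h.c0002, h.c0222, h.c0122, h.c0001, h.c0111]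
  ring

lemma d2_symm (h : HasCoords D x y z a₁ a₂ b₁ b₂ c₁ c₂) (i j : Fin 3) : d2 D i j = d2 D j i := by
  have hpair : ∀ a b c d, D a b c d = D c d a b := fun a b c d => by
    rw [h.swap₂ a b, h.swap₁ a c, h.swap₃ c a, h.swap₂ c a]
  simp only [d2, sqT, of_apply]
  refine Finset.sum_congr rfl fun k _ => Finset.sum_congr rfl fun p _ =>
    Finset.sum_congr rfl fun q _ => ?_
  rw [hpair k i, hpair p q k j]
  ring

lemma J4_eq (h : HasCoords D x y z a₁ a₂ b₁ b₂ c₁ c₂) : J4 D = d2 D 0 0 ^ 2 + d2 D 1 1 ^ 2 + d2 D 2 2 ^ 2 +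
    2 * d2 D 0 1 ^ 2 + 2 * d2 D 0 2 ^ 2 + 2 * d2 D 1 2 ^ 2 := by
  simp only [J4, trace, diag, Matrix.mul_apply, Fin.sum_univ_three, h.d2_symm 1 0, h.d2_symm 2 0,
    h.d2_symm 2 1]
  ring

lemma J5_eq (h : HasCoords D x y z a₁ a₂ b₁ b₂ c₁ c₂) : J5 D =
    d2 D 0 0 ^ 2 * (-x - y) +
    d2 D 1 1 ^ 2 * (-x - z) +
    d2 D 2 2 ^ 2 * (-y - z) +
    (2 * d2 D 0 0 * d2 D 1 1 + 4 * d2 D 0 1 ^ 2) * x +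
    (2 * d2 D 0 0 * d2 D 2 2 + 4 * d2 D 0 2 ^ 2) * y +
    (2 * d2 D 1 1 * d2 D 2 2 + 4 * d2 D 1 2 ^ 2) * z +
    (4 * d2 D 0 0 * d2 D 1 2 + 8 * d2 D 0 1 * d2 D 0 2) * (-a₁ - a₂) +
    4 * d2 D 1 1 * d2 D 1 2 * a₁ +
    4 * d2 D 1 2 * d2 D 2 2 * a₂ +
    (8 * d2 D 0 1 * d2 D 1 2 + 4 * d2 D 0 2 * d2 D 1 1) * (-b₁ - b₂) +
    4 * d2 D 0 0 * d2 D 0 2 * b₁ +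
    4 * d2 D 0 2 * d2 D 2 2 * b₂ +
    (4 * d2 D 0 1 * d2 D 2 2 + 8 * d2 D 0 2 * d2 D 1 2) * (-c₁ - c₂) +
    4 * d2 D 0 0 * d2 D 0 1 * c₁ +
    4 * d2 D 0 1 * d2 D 1 1 * c₂ := by
  simp only [J5, Fin.sum_univ_three, h.d2_symm 1 0, h.d2_symm 2 0, h.d2_symm 2 1,
    h.swap₁ 1 0, h.swap₁ 2 0, h.swap₁ 2 1,
    h.swap₂ _ 1 0, h.swap₂ _ 2 0, h.swap₂ _ 2 1, h.swap₃ _ _ 1 0, h.swap₃ _ _ 2 0, h.swap₃ _ _ 2 1,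
    h.c0000, h.c1111, h.c2222, h.c0011, h.c0022, h.c1122, h.c0012, h.c1112, h.c1222, h.c0112,
    h.c0002, h.c0222, h.c0122, h.c0001, h.c0111]
  ring

lemma scalar_sub_pairMatrix (h : HasCoords D x y z a₁ a₂ b₁ b₂ c₁ c₂) (t : ℝ) :
    Matrix.scalar (Fin 6) t - pairMatrix D * diagonal ![1, 1, 1, 2, 2, 2] =
      !![t + (x + y), -x, -y, 2 * (a₁ + a₂), -(2 * b₁), -(2 * c₁);
         -x, t + (x + z), -z, -(2 * a₁), 2 * (b₁ + b₂), -(2 * c₂);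
         -y, -z, t + (y + z), -(2 * a₂), -(2 * b₂), 2 * (c₁ + c₂);
         a₁ + a₂, -a₁, -a₂, t - 2 * z, 2 * (c₁ + c₂), 2 * (b₁ + b₂);
         -b₁, b₁ + b₂, -b₂, 2 * (c₁ + c₂), t - 2 * y, 2 * (a₁ + a₂);
         -c₁, -c₂, c₁ + c₂, 2 * (b₁ + b₂), 2 * (a₁ + a₂), t - 2 * x] := by
  ext m n
  fin_cases m <;> fin_cases n <;>
    simp [pairMatrix, kidx, h.swap₁ 1 0, h.swap₁ 2 0, h.swap₁ 2 1,
    h.swap₂ _ 1 0, h.swap₂ _ 2 0, h.swap₂ _ 2 1, h.swap₃ _ _ 1 0, h.swap₃ _ _ 2 0, h.swap₃ _ _ 2 1,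
    h.c0000, h.c1111, h.c2222, h.c0011, h.c0022, h.c1122, h.c0012, h.c1112, h.c1222, h.c0112,
    h.c0002, h.c0222, h.c0122, h.c0001, h.c0111] <;> ring

end HasCoords

/-- The trace direction splits off the characteristic determinant of the weighted pair matrix. -/
lemma det_harmonic (t x y z a₁ a₂ b₁ b₂ c₁ c₂ : ℝ) :
    (!![t + (x + y), -x, -y, 2 * (a₁ + a₂), -(2 * b₁), -(2 * c₁);
       -x, t + (x + z), -z, -(2 * a₁), 2 * (b₁ + b₂), -(2 * c₂);
       -y, -z, t + (y + z), -(2 * a₂), -(2 * b₂), 2 * (c₁ + c₂);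
       a₁ + a₂, -a₁, -a₂, t - 2 * z, 2 * (c₁ + c₂), 2 * (b₁ + b₂);
       -b₁, b₁ + b₂, -b₂, 2 * (c₁ + c₂), t - 2 * y, 2 * (a₁ + a₂);
       -c₁, -c₂, c₁ + c₂, 2 * (b₁ + b₂), 2 * (a₁ + a₂), t - 2 * x] :
      Matrix (Fin 6) (Fin 6) ℝ).det =
    t * (!![t + (2 * x + z), x - z, -(2 * a₁), 2 * (b₁ + b₂), -(2 * c₂);
       y - z, t + (2 * y + z), -(2 * a₂), -(2 * b₂), 2 * (c₁ + c₂);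
       -(2 * a₁ + a₂), -(a₁ + 2 * a₂), t - 2 * z, 2 * (c₁ + c₂), 2 * (b₁ + b₂);
       2 * b₁ + b₂, b₁ - b₂, 2 * (c₁ + c₂), t - 2 * y, 2 * (a₁ + a₂);
       c₁ - c₂, 2 * c₁ + c₂, 2 * (b₁ + b₂), 2 * (a₁ + a₂), t - 2 * x] :
      Matrix (Fin 5) (Fin 5) ℝ).det := by
  rw [det_eq_mul_det_of_row_sum _ t]
  · congr 2
    ext i j
    fin_cases i <;> fin_cases j <;> simp <;> ring
  · intro j
    fin_cases j <;> simp <;> ring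

set_option maxRecDepth 10000 in
lemma HasCoords.det_eq {D : T4} {x y z a₁ a₂ b₁ b₂ c₁ c₂ : ℝ} (h : HasCoords D x y z a₁ a₂ b₁ b₂ c₁ c₂) (t : ℝ) :
    (Matrix.scalar (Fin 6) t - pairMatrix D * diagonal ![1, 1, 1, 2, 2, 2]).det =
      t ^ 6 - J2 D / 2 * t ^ 4 - J3 D / 3 * t ^ 3 + ((J2 D) ^ 2 - 2 * J4 D) / 5 * t ^ 2 +
        (2 / 25) * (J2 D * J3 D - 3 * J5 D) * t := by
  have hJ2 : J2 D = d2 D 0 0 + d2 D 1 1 + d2 D 2 2 := by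
    simp only [J2, trace, diag, Fin.sum_univ_three]
  rw [h.scalar_sub_pairMatrix, det_harmonic, hJ2, h.J3_eq, h.J4_eq, h.J5_eq, h.d2_00, h.d2_11,
    h.d2_22, h.d2_01, h.d2_02, h.d2_12]
  simp only [det_fin_five_laplace, det_fin_four_laplace, det_fin_three, submatrix_apply, of_apply,
    cons_val]
  ring

/-- A fourth-order tensor as an endomorphism of the `3 × 3` matrices. -/
def tensorMatrix (D : T4) : Matrix (Fin 3 × Fin 3) (Fin 3 × Fin 3) ℝ :=
  Matrix.of fun a b => D a.1 a.2 b.1 b.2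

/-- The matrix whose rows are the Kelvin basis of the symmetric `3 × 3` matrices. -/
noncomputable def kelvinEmb : Matrix (Fin 6) (Fin 3 × Fin 3) ℝ :=
  Matrix.of fun m a =>
    (kw m / 2) * ((if kidx m = a then 1 else 0) + if (kidx m).swap = a then 1 else 0)

lemma kelvin_eq_emb {D : T4} (h₁ : ∀ i j k l, D i j k l = D j i k l)
    (h₃ : ∀ i j k l, D i j k l = D i j l k) :
    kelvin D = kelvinEmb * (tensorMatrix D * kelvinEmbᵀ) := by
  ext m n
  simp only [kelvin, kelvinEmb, tensorMatrix, mul_apply, of_apply, transpose_apply, mul_add,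
    add_mul, Finset.sum_add_distrib, mul_ite, ite_mul, mul_one, mul_zero, zero_mul,
    Finset.sum_ite_eq, Finset.mem_univ, if_true, Prod.fst_swap, Prod.snd_swap]
  rw [h₁ (kidx m).2, h₁ (kidx m).2, h₃ _ _ (kidx n).2]
  ring

lemma emb_mul {D : T4} (h₁ : ∀ i j k l, D i j k l = D j i k l) :
    kelvinEmbᵀ * kelvinEmb * tensorMatrix D = tensorMatrix D := by
  have hP : ∀ a b : Fin 3 × Fin 3, (kelvinEmbᵀ * kelvinEmb) a b =
      ((if a = b then 1 else 0) + if a.swap = b then 1 else 0) / 2 := by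
    rintro ⟨i, j⟩ ⟨k, l⟩
    have hs : √2 * √2 = (2:ℝ) := by simp
    fin_cases i <;> fin_cases j <;> fin_cases k <;> fin_cases l <;>
      simp [mul_apply, kelvinEmb, Fin.sum_univ_six, kidx, kw] <;> linarith
  ext a b
  rw [Matrix.mul_apply]
  simp only [hP, add_div, ite_div, add_mul, ite_mul, zero_mul, zero_div,
    Finset.sum_add_distrib, Finset.sum_ite_eq, Finset.mem_univ, if_true]
  simp only [tensorMatrix, of_apply, Prod.fst_swap, Prod.snd_swap]
  rw [h₁ a.2]
  ring

open Polynomial in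
lemma X_pow_three_mul_charpoly (A : Matrix (Fin 6) (Fin 3 × Fin 3) ℝ)
    (B : Matrix (Fin 3 × Fin 3) (Fin 6) ℝ) :
    X ^ 3 * (A * B).charpoly = (B * A).charpoly := by
  have h := charpoly_mul_comm_of_le B A (by simp)
  simp only [Fintype.card_prod, Fintype.card_fin, Nat.reduceMul, Nat.reduceSub] at h
  rw [h]

open Polynomial in
lemma charpoly_tensorMatrix {D : T4} (h₁ : ∀ i j k l, D i j k l = D j i k l)
    (h₃ : ∀ i j k l, D i j k l = D i j l k) :
    (tensorMatrix D).charpoly = X ^ 3 * (kelvin D).charpoly := by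
  rw [kelvin_eq_emb h₁ h₃, X_pow_three_mul_charpoly, Matrix.mul_assoc, charpoly_mul_comm,
    emb_mul h₁]

open scoped Kronecker in
lemma tensorMatrix_act (g : Mat3) (D : T4) :
    tensorMatrix (act g D) = (g ⊗ₖ g) * (tensorMatrix D * (g ⊗ₖ g)ᵀ) := by
  ext a b
  simp only [tensorMatrix, act, mul_apply, of_apply, transpose_apply, kroneckerMap_apply,
    Fintype.sum_prod_type, Finset.mul_sum]
  refine Finset.sum_congr rfl fun p _ => Finset.sum_congr rfl fun q _ =>
    Finset.sum_congr rfl fun r _ => Finset.sum_congr rfl fun s _ => ?_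
  ring

open scoped Kronecker in
lemma charpoly_tensorMatrix_act {g : Mat3} (hg : g * gᵀ = 1) (D : T4) :
    (tensorMatrix (act g D)).charpoly = (tensorMatrix D).charpoly := by
  have hg' : gᵀ * g = 1 := mul_eq_one_comm.mp hg
  have hk : (g ⊗ₖ g)ᵀ * (g ⊗ₖ g) = 1 := by
    rw [← kroneckerMap_transpose, ← mul_kronecker_mul, hg', one_kronecker_one]
  rw [tensorMatrix_act, charpoly_mul_comm, Matrix.mul_assoc, hk, Matrix.mul_one]

lemma act_swap_left {D : T4} (h : ∀ i j k l, D i j k l = D j i k l) (g : Mat3) (i j k l : Fin 3) :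
    act g D i j k l = act g D j i k l := by
  unfold act
  rw [Finset.sum_comm]
  refine Finset.sum_congr rfl fun p _ => Finset.sum_congr rfl fun q _ =>
    Finset.sum_congr rfl fun r _ => Finset.sum_congr rfl fun s _ => ?_
  rw [h q p]
  ring

lemma act_swap_right {D : T4} (h : ∀ i j k l, D i j k l = D i j l k) (g : Mat3)
    (i j k l : Fin 3) : act g D i j k l = act g D i j l k := by
  unfold act
  refine Finset.sum_congr rfl fun p _ => Finset.sum_congr rfl fun q _ => ?_
  rw [Finset.sum_comm]
  refine Finset.sum_congr rfl fun r _ => Finset.sum_congr rfl fun s _ => ?_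
  rw [h p q s r]
  ring

open Polynomial in
lemma charpoly_kelvin_act {D : T4} (h₁ : ∀ i j k l, D i j k l = D j i k l)
    (h₃ : ∀ i j k l, D i j k l = D i j l k) {g : Mat3} (hg : g * gᵀ = 1) :
    (kelvin (act g D)).charpoly = (kelvin D).charpoly := by
  refine mul_left_cancel₀ (pow_ne_zero 3 X_ne_zero) ?_
  rw [← charpoly_tensorMatrix (act_swap_left h₁ g) (act_swap_right h₃ g),
    charpoly_tensorMatrix_act hg, charpoly_tensorMatrix h₁ h₃]

open Polynomial in
/-- for every `D ∈ H⁴`, the characteristic polynomial of its Kelvin matrix is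
`X⁶ − (J₂/2)X⁴ − (J₃/3)X³ + ((J₂² − 2J₄)/5)X² + (2/25)(J₂J₃ − 3J₅)X`; in particular `0` is an
eigenvalue, and the characteristic polynomial (hence all its coefficients) is an
`SO(3)`-invariant of `D`. -/
theorem kelvin_charpoly (D : T4) (hD : IsHarm D) :
    (kelvin D).charpoly =
      X ^ 6 - C (J2 D / 2) * X ^ 4 - C (J3 D / 3) * X ^ 3 +
        C (((J2 D) ^ 2 - 2 * J4 D) / 5) * X ^ 2 +
        C ((2 / 25) * (J2 D * J3 D - 3 * J5 D)) * X ∧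
    (kelvin D).charpoly.IsRoot 0 ∧
    (∀ g : Mat3, IsSO3 g → (kelvin (act g D)).charpoly = (kelvin D).charpoly) := by
  have hchar : (kelvin D).charpoly =
      X ^ 6 - C (J2 D / 2) * X ^ 4 - C (J3 D / 3) * X ^ 3 +
        C (((J2 D) ^ 2 - 2 * J4 D) / 5) * X ^ 2 +
        C ((2 / 25) * (J2 D * J3 D - 3 * J5 D)) * X := by
    refine Polynomial.funext fun t => ?_
    rw [kelvin_charpoly_eq_pairMatrix, eval_charpoly, hD.hasCoords.det_eq]
    simp only [eval_add, eval_sub, eval_mul, eval_pow, eval_X, eval_C]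
  refine ⟨hchar, ?_, fun g hg => charpoly_kelvin_act hD.1 hD.2.2.1 hg.1⟩
  rw [hchar]
  simp
end
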